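/- arXiv:1109.3304 — 2 statements merged into one kernel-verified Lean document; each statement's English description precedes it below -/
import Mathlib

section
/- Let λ>0 and 1<p≤q<∞, and let v,w be non-negative measurable weights on (0,∞) with v^{p'} and w^q locally integrable. Define A_H(t)=(∫_0^t v^{p'})^{1/p'} (∫_t^∞ x^{−λq} w(x)^q dx)^{1/q} and A_{H*}(t)=(∫_t^∞ y^{−λp'} v(y)^{p'} dy)^{1/p'} (∫_0^t w^q)^{1/q}. Then the Stieltjes-type operator S is compact from L^p to L^q if and only if sup_{t>0}[A_H(t)+A_{H*}(t)]<∞, lim_{t→0⁺}[A_H(t)+A_{H*}(t)]=0 and lim_{t→∞}[A_H(t)+A_{H*}(t)]=0. -/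
open MeasureTheory Set Filter Topology
open scoped ENNReal NNReal

noncomputable section

/-- The Stieltjes-type operator `Sf(x) = w(x) ∫_0^∞ f(y) v(y)/(x^λ + y^λ) dy`. -/
def SOp (lam : ℝ) (v w f : ℝ → ℝ) : ℝ → ℝ :=
  fun x => w x * ∫ y in Ioi (0:ℝ), f y * v y / (x ^ lam + y ^ lam)

/-- `(∫_0^∞ |g|^r)^{1/r}`, the `L^r(0,∞)` (quasi-)norm. -/
def eN (r : ℝ) (g : ℝ → ℝ) : ℝ≥0∞ :=
  (∫⁻ x in Ioi (0:ℝ), ENNReal.ofReal |g x| ^ r) ^ (1/r)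

/-- `V₀(t) = ∫_0^t v^{p'}`. -/
def V0 (p' : ℝ) (v : ℝ → ℝ) (t : ℝ) : ℝ≥0∞ :=
  ∫⁻ y in Ioo (0:ℝ) t, ENNReal.ofReal (v y) ^ p'

/-- `𝒱_t(∞) = ∫_t^∞ y^{-λp'} v(y)^{p'} dy`. -/
def Vinf (lam p' : ℝ) (v : ℝ → ℝ) (t : ℝ) : ℝ≥0∞ :=
  ∫⁻ y in Ioi t, (ENNReal.ofReal y) ^ (-(lam * p')) * ENNReal.ofReal (v y) ^ p'

/-- `W₀(t) = ∫_0^t w^q`. -/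
def W0 (q : ℝ) (w : ℝ → ℝ) (t : ℝ) : ℝ≥0∞ :=
  ∫⁻ x in Ioo (0:ℝ) t, ENNReal.ofReal (w x) ^ q

/-- `𝒲_t(∞) = ∫_t^∞ x^{-λq} w(x)^q dx`. -/
def Winf (lam q : ℝ) (w : ℝ → ℝ) (t : ℝ) : ℝ≥0∞ :=
  ∫⁻ x in Ioi t, (ENNReal.ofReal x) ^ (-(lam * q)) * ENNReal.ofReal (w x) ^ q

/-- Compactness of the Stieltjes-type operator from `L^p` to `L^q` (`q ≥ 1`): the image of the
closed unit ball of `L^p` is relatively compact in the complete space `L^q`; equivalently,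
every sequence of the unit ball has a subsequence whose image is Cauchy in the `L^q` norm. -/
def SCompact (lam p q : ℝ) (v w : ℝ → ℝ) : Prop :=
  ∀ f : ℕ → ℝ → ℝ, (∀ n, Measurable (f n)) → (∀ n, eN p (f n) ≤ 1) →
    ∃ φ : ℕ → ℕ, StrictMono φ ∧
      ∀ ε : ℝ, 0 < ε → ∃ N : ℕ, ∀ m, N ≤ m → ∀ n, N ≤ n →
        eN q (fun x => SOp lam v w (f (φ m)) x - SOp lam v w (f (φ n)) x) < ENNReal.ofReal ε

/-- The `ℓ^1`-norm dominates the `ℓ^r`-norm for `r ≥ 1`. -/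
lemma ENNReal.tsum_rpow_le_rpow_tsum {ι : Type*} (a : ι → ℝ≥0∞) {r : ℝ} (hr : 1 ≤ r) :
    ∑' k, a k ^ r ≤ (∑' k, a k) ^ r := by
  have key : ∀ x : ℝ≥0∞, x ^ r = x * x ^ (r - 1) := fun x => by
    conv_lhs => rw [show r = 1 + (r - 1) by ring]
    rw [ENNReal.rpow_add_of_nonneg _ _ zero_le_one (by linarith), ENNReal.rpow_one]
  calc ∑' k, a k ^ r ≤ ∑' k, a k * (∑' k, a k) ^ (r - 1) := by
        refine ENNReal.tsum_le_tsum fun k => ?_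
        rw [key]
        gcongr
        exact ENNReal.le_tsum k
    _ = (∑' k, a k) ^ r := by rw [ENNReal.tsum_mul_right, ← key]

section Primitive

variable {g : ℝ → ℝ≥0∞}

lemma monotone_lintegral_Iio : Monotone fun x => ∫⁻ y in Iio x, g y :=
  fun _ _ h => lintegral_mono_set (Iio_subset_Iio h)

lemma continuous_lintegral_Iio (hg : Measurable g) (hfin : ∫⁻ y, g y ≠ ⊤) :
    Continuous fun x => ∫⁻ y in Iio x, g y := by
  refine continuous_iff_continuousAt.2 fun x₀ => ?_
  simp only [ContinuousAt, ← lintegral_indicator measurableSet_Iio]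
  refine tendsto_lintegral_filter_of_dominated_convergence g
    (.of_forall fun x => hg.indicator measurableSet_Iio)
    (.of_forall fun x => .of_forall fun y => indicator_le_self _ _ _) hfin ?_
  filter_upwards [compl_mem_ae_iff.2 (measure_singleton x₀)] with y hy
  refine tendsto_const_nhds.congr' ?_
  rcases lt_or_gt_of_ne (show y ≠ x₀ from hy) with h | h
  · filter_upwards [lt_mem_nhds h] with x hx
    simp [indicator, h, hx]
  · filter_upwards [gt_mem_nhds h] with x hx
    simp [indicator, h.not_gt, hx.not_gt]

lemma tendsto_lintegral_Iio_atBot (hg : Measurable g) (hfin : ∫⁻ y, g y ≠ ⊤) :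
    Tendsto (fun x => ∫⁻ y in Iio x, g y) atBot (𝓝 0) := by
  simp only [← lintegral_indicator measurableSet_Iio]
  rw [← lintegral_zero (μ := (volume : Measure ℝ))]
  refine tendsto_lintegral_filter_of_dominated_convergence g
    (.of_forall fun x => hg.indicator measurableSet_Iio)
    (.of_forall fun x => .of_forall fun y => indicator_le_self _ _ _) hfin (.of_forall fun y => ?_)
  refine tendsto_const_nhds.congr' ?_
  filter_upwards [eventually_le_atBot y] with x hx
  simp [indicator, hx]

/-- The first point at which the primitive of `g` attains a given level. -/
lemma exists_lintegral_Iio_eq (hg : Measurable g) (hfin : ∫⁻ y, g y ≠ ⊤) {c : ℝ≥0∞} (hc : 0 < c)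
    {x : ℝ} (hx : c ≤ ∫⁻ y in Iio x, g y) :
    ∃ t, ∫⁻ y in Iio t, g y = c ∧ ∀ y, c ≤ ∫⁻ z in Iio y, g z ↔ t ≤ y := by
  set F := fun x => ∫⁻ y in Iio x, g y
  have hF : Continuous F := continuous_lintegral_Iio hg hfin
  have hcl : IsClosed {x | c ≤ F x} := isClosed_le continuous_const hF
  obtain ⟨z, hz⟩ := eventually_atBot.1
    ((tendsto_lintegral_Iio_atBot hg hfin).eventually_lt_const hc)
  have hbdd : BddBelow {x | c ≤ F x} :=
    ⟨z, fun y hy => le_of_not_ge fun h => (hz y h).not_ge hy⟩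
  have hmem : c ≤ F (sInf {x | c ≤ F x}) := hcl.csInf_mem ⟨x, hx⟩ hbdd
  refine ⟨sInf {x | c ≤ F x}, le_antisymm ?_ hmem, fun y => ⟨fun hy => csInf_le hbdd hy,
    fun hy => hmem.trans (monotone_lintegral_Iio hy)⟩⟩
  refine le_of_tendsto (hF.continuousWithinAt (s := Iio (sInf {x | c ≤ F x}))) ?_
  filter_upwards [self_mem_nhdsWithin] with y hy
  exact le_of_not_ge fun h => (csInf_le hbdd h).not_gt hy

end Primitive

section Hardy

variable {p p' q : ℝ} {f u W : ℝ → ℝ≥0∞} {B : ℝ≥0∞}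

lemma hardy_level_estimate (hpp : p.HolderConjugate p') (hpq : p ≤ q) (hf : Measurable f)
    (hu : Measurable u) (hW : Measurable W) (hfin : ∫⁻ y, f y * u y ≠ ⊤)
    (hB : ∀ t, (∫⁻ y in Iio t, u y ^ p') ^ (1 / p') * (∫⁻ x in Ioi t, W x ^ q) ^ (1 / q) ≤ B)
    {F : ℝ → ℝ≥0∞} (hF : F = fun x => ∫⁻ y in Iio x, f y * u y) (k : ℤ) :
    ∫⁻ x in F ⁻¹' Ico ((2 : ℝ≥0∞) ^ k) (2 ^ (k + 1)), (W x * F x) ^ q ≤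
      (4 * B) ^ q *
        (∫⁻ y in F ⁻¹' Ico ((2 : ℝ≥0∞) ^ (k - 1)) (2 ^ (k - 1 + 1)), f y ^ p) ^ (q / p) := by
  have hp0 : 0 < p := hpp.pos
  have hq0 : 0 < q := hp0.trans_le hpq
  have hfu : Measurable fun y => f y * u y := hf.mul hu
  have hFm : Measurable F := hF ▸ monotone_lintegral_Iio.measurable
  have h2 : (2 : ℝ≥0∞) ≠ 0 := two_ne_zero
  have h2' : (2 : ℝ≥0∞) ≠ ⊤ := ENNReal.ofNat_ne_top
  have hpos : ∀ j : ℤ, 0 < (2 : ℝ≥0∞) ^ j := fun j => ENNReal.zpow_pos h2 h2' j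
  have hdouble : ∀ j : ℤ, (2 : ℝ≥0∞) ^ (j + 1) = 2 * 2 ^ j := fun j => by
    rw [ENNReal.zpow_add h2 h2', zpow_one, mul_comm]
  rcases (F ⁻¹' Ico ((2 : ℝ≥0∞) ^ k) (2 ^ (k + 1))).eq_empty_or_nonempty with he | ⟨x, hx⟩
  · simp [he]
  have hxk : (2 : ℝ≥0∞) ^ k ≤ ∫⁻ y in Iio x, f y * u y := by simpa [hF] using hx.1
  have hxk' : (2 : ℝ≥0∞) ^ (k - 1) ≤ ∫⁻ y in Iio x, f y * u y := by
    refine le_trans ?_ hxk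
    conv_rhs => rw [← sub_add_cancel k 1, hdouble]
    exact le_mul_of_one_le_left' one_le_two
  obtain ⟨t, ht, ht'⟩ := exists_lintegral_Iio_eq hfu hfin (hpos k) hxk
  obtain ⟨s, hs, hs'⟩ := exists_lintegral_Iio_eq hfu hfin (hpos (k - 1)) hxk'
  set J := F ⁻¹' Ico ((2 : ℝ≥0∞) ^ (k - 1)) (2 ^ (k - 1 + 1))
  have hJm : MeasurableSet J := hFm measurableSet_Ico
  have hmass : (2 : ℝ≥0∞) ^ (k - 1) ≤ ∫⁻ y in J ∩ Iio t, f y * u y := by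
    have hsub : Iio t ⊆ Iio s ∪ (J ∩ Iio t) := by
      intro y hy
      rcases lt_or_ge y s with h | h
      · exact Or.inl h
      · refine Or.inr ⟨⟨?_, ?_⟩, hy⟩
        · simpa [hF] using (hs' y).2 h
        · rw [sub_add_cancel]
          refine lt_of_not_ge fun h' => ?_
          exact absurd ((ht' y).1 (by simpa [hF] using h')) (not_le.2 hy)
    have h1 : (2 : ℝ≥0∞) ^ k ≤ 2 ^ (k - 1) + ∫⁻ y in J ∩ Iio t, f y * u y := by
      rw [← ht, ← hs]
      exact (lintegral_mono_set hsub).trans (lintegral_union_le _ _ _)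
    have h3 : (2 : ℝ≥0∞) ^ k = 2 ^ (k - 1) + 2 ^ (k - 1) := by
      rw [← two_mul, ← hdouble, sub_add_cancel]
    rw [h3] at h1
    exact (ENNReal.add_le_add_iff_left (ENNReal.zpow_ne_top h2 h2' _)).1 h1
  have hholder : (2 : ℝ≥0∞) ^ (k - 1) ≤
      (∫⁻ y in J, f y ^ p) ^ (1 / p) * (∫⁻ y in Iio t, u y ^ p') ^ (1 / p') := by
    refine hmass.trans ((ENNReal.lintegral_mul_le_Lp_mul_Lq _ hpp hf.aemeasurable
      hu.aemeasurable).trans ?_)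
    have := hpp.symm.pos
    gcongr
    · exact inter_subset_left
    · exact inter_subset_right
  have hsub : F ⁻¹' Ico ((2 : ℝ≥0∞) ^ k) (2 ^ (k + 1)) ⊆ Ici t := fun y hy =>
    (ht' y).1 (by simpa [hF] using hy.1)
  have hq1 : ∀ y : ℝ≥0∞, (y ^ (1 / q)) ^ q = y := fun y => by
    rw [← ENNReal.rpow_mul, one_div_mul_cancel hq0.ne', ENNReal.rpow_one]
  have hfour : (2 : ℝ≥0∞) ^ (k + 1) = 4 * 2 ^ (k - 1) := by
    rw [hdouble, ← sub_add_cancel k 1, hdouble, ← mul_assoc]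
    norm_num
  calc ∫⁻ x in F ⁻¹' Ico ((2 : ℝ≥0∞) ^ k) (2 ^ (k + 1)), (W x * F x) ^ q
      ≤ ∫⁻ x in F ⁻¹' Ico ((2 : ℝ≥0∞) ^ k) (2 ^ (k + 1)), (2 ^ (k + 1)) ^ q * W x ^ q := by
        refine setLIntegral_mono' (hFm measurableSet_Ico) fun y hy => ?_
        rw [← ENNReal.mul_rpow_of_nonneg _ _ hq0.le, mul_comm]
        gcongr
        exact hy.2.le
    _ ≤ ∫⁻ x in Ici t, (2 ^ (k + 1)) ^ q * W x ^ q := lintegral_mono_set hsub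
    _ = (2 ^ (k + 1)) ^ q * ∫⁻ x in Ioi t, W x ^ q := by
        rw [lintegral_const_mul _ (hW.pow_const q), setLIntegral_congr Ioi_ae_eq_Ici]
    _ = (2 ^ (k + 1) * (∫⁻ x in Ioi t, W x ^ q) ^ (1 / q)) ^ q := by
        rw [ENNReal.mul_rpow_of_nonneg _ _ hq0.le, hq1]
    _ ≤ (4 * B * (∫⁻ y in J, f y ^ p) ^ (1 / p)) ^ q := by
        refine ENNReal.rpow_le_rpow ?_ hq0.le
        rw [hfour]
        calc 4 * (2 : ℝ≥0∞) ^ (k - 1) * (∫⁻ x in Ioi t, W x ^ q) ^ (1 / q)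
            ≤ 4 * ((∫⁻ y in J, f y ^ p) ^ (1 / p) * (∫⁻ y in Iio t, u y ^ p') ^ (1 / p')) *
              (∫⁻ x in Ioi t, W x ^ q) ^ (1 / q) := by gcongr
          _ = 4 * ((∫⁻ y in Iio t, u y ^ p') ^ (1 / p') * (∫⁻ x in Ioi t, W x ^ q) ^ (1 / q)) *
              (∫⁻ y in J, f y ^ p) ^ (1 / p) := by ring
          _ ≤ _ := by gcongr; exact hB t
    _ = _ := by
        rw [ENNReal.mul_rpow_of_nonneg _ _ hq0.le, ← ENNReal.rpow_mul]
        congr 2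
        ring

lemma hardy_of_lintegral_ne_top (hpp : p.HolderConjugate p') (hpq : p ≤ q) (hf : Measurable f)
    (hu : Measurable u) (hW : Measurable W) (hfin : ∫⁻ y, f y * u y ≠ ⊤)
    (hB : ∀ t, (∫⁻ y in Iio t, u y ^ p') ^ (1 / p') * (∫⁻ x in Ioi t, W x ^ q) ^ (1 / q) ≤ B) :
    ∫⁻ x, (W x * ∫⁻ y in Iio x, f y * u y) ^ q ≤ (4 * B) ^ q * (∫⁻ y, f y ^ p) ^ (q / p) := by
  have hp0 : 0 < p := hpp.pos
  have hq0 : 0 < q := hp0.trans_le hpq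
  obtain ⟨F, hF⟩ : ∃ F : ℝ → ℝ≥0∞, F = fun x => ∫⁻ y in Iio x, f y * u y := ⟨_, rfl⟩
  have hFm : Measurable F := hF ▸ monotone_lintegral_Iio.measurable
  have hFtop : ∀ x, F x ≠ ⊤ := fun x =>
    ne_top_of_le_ne_top hfin (hF ▸ setLIntegral_le_lintegral _ _)
  have hlevel := hardy_level_estimate hpp hpq hf hu hW hfin hB hF
  have hdec := fun ν : Measure ℝ => measure_eq_measure_preimage_add_measure_tsum_Ico_zpow ν
    hFm MeasurableSet.univ (t := 2) one_lt_two
  simp only [univ_inter, ENNReal.coe_ofNat] at hdec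
  have hms : ∀ j : ℤ, MeasurableSet (F ⁻¹' Ico ((2 : ℝ≥0∞) ^ j) (2 ^ (j + 1))) :=
    fun j => hFm measurableSet_Ico
  have hWF := hdec (volume.withDensity fun x => (W x * F x) ^ q)
  have hfp := hdec (volume.withDensity fun x => f x ^ p)
  have h0 : ∫⁻ x in F ⁻¹' {0}, (W x * F x) ^ q = 0 := by
    rw [setLIntegral_congr_fun (g := 0) (hFm (measurableSet_singleton 0))]
    · simp
    · intro x hx
      simp [show F x = 0 from hx, hq0]
  have htop : F ⁻¹' {∞} = ∅ := eq_empty_of_forall_notMem fun x hx => hFtop x hx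
  simp only [htop, measure_empty, withDensity_apply _ MeasurableSet.univ, withDensity_apply _ (hms _),
    withDensity_apply _ (hFm (measurableSet_singleton _)), Measure.restrict_univ, h0,
    zero_add, add_zero] at hWF hfp
  have hgoal : ∫⁻ x, (W x * ∫⁻ y in Iio x, f y * u y) ^ q = ∫⁻ x, (W x * F x) ^ q := by rw [hF]
  rw [hgoal, hWF]
  calc _ ≤ ∑' k : ℤ, (4 * B) ^ q *
        (∫⁻ y in F ⁻¹' Ico ((2 : ℝ≥0∞) ^ (k - 1)) (2 ^ (k - 1 + 1)), f y ^ p) ^ (q / p) :=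
        ENNReal.tsum_le_tsum hlevel
    _ = (4 * B) ^ q * ∑' k : ℤ,
        (∫⁻ y in F ⁻¹' Ico ((2 : ℝ≥0∞) ^ k) (2 ^ (k + 1)), f y ^ p) ^ (q / p) := by
        rw [ENNReal.tsum_mul_left]
        congr 1
        exact (Equiv.subRight (1 : ℤ)).tsum_eq fun k : ℤ =>
          (∫⁻ y in F ⁻¹' Ico ((2 : ℝ≥0∞) ^ k) (2 ^ (k + 1)), f y ^ p) ^ (q / p)
    _ ≤ (4 * B) ^ q * (∑' k : ℤ,
        ∫⁻ y in F ⁻¹' Ico ((2 : ℝ≥0∞) ^ k) (2 ^ (k + 1)), f y ^ p) ^ (q / p) := by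
        gcongr
        exact ENNReal.tsum_rpow_le_rpow_tsum _ ((one_le_div hp0).2 hpq)
    _ ≤ (4 * B) ^ q * (∫⁻ y, f y ^ p) ^ (q / p) := by
        gcongr
        rw [hfp]
        exact le_add_self

/-- The weighted Hardy inequality for `1 < p ≤ q`. -/
theorem hardy (hpp : p.HolderConjugate p') (hpq : p ≤ q) (hf : Measurable f)
    (hu : Measurable u) (hW : Measurable W) (hfu : ∀ y, f y * u y ≠ ⊤)
    (hB : ∀ t, (∫⁻ y in Iio t, u y ^ p') ^ (1 / p') * (∫⁻ x in Ioi t, W x ^ q) ^ (1 / q) ≤ B) :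
    ∫⁻ x, (W x * ∫⁻ y in Iio x, f y * u y) ^ q ≤ (4 * B) ^ q * (∫⁻ y, f y ^ p) ^ (q / p) := by
  have hp0 : 0 < p := hpp.pos
  have hq0 : 0 < q := hp0.trans_le hpq
  let S : ℕ → Set ℝ := fun n => Icc (-(n : ℝ)) n ∩ {y | f y * u y ≤ n}
  have hSm : ∀ n, MeasurableSet (S n) := fun n =>
    measurableSet_Icc.inter (measurableSet_le (hf.mul hu) measurable_const)
  have hSmono : Monotone S := fun m n hmn => by
    have : (m : ℝ) ≤ n := by exact_mod_cast hmn
    refine inter_subset_inter (Icc_subset_Icc (by linarith) this) fun y hy => ?_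
    exact le_trans (show f y * u y ≤ m from hy) (by exact_mod_cast hmn)
  have hSU : ⋃ n, S n = univ := by
    refine eq_univ_of_forall fun y => ?_
    obtain ⟨m, hm⟩ := exists_nat_ge |y|
    obtain ⟨n, hn⟩ := ENNReal.exists_nat_gt (hfu y)
    refine mem_iUnion.2 ⟨max m n, ⟨abs_le.1 (hm.trans ?_), hn.le.trans ?_⟩⟩
    · exact_mod_cast le_max_left m n
    · exact_mod_cast le_max_right m n
  have hbound : ∀ n, ∫⁻ x, (W x * ∫⁻ y in Iio x, (S n).indicator f y * u y) ^ q ≤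
      (4 * B) ^ q * (∫⁻ y, f y ^ p) ^ (q / p) := fun n => by
    refine (hardy_of_lintegral_ne_top hpp hpq (hf.indicator (hSm n)) hu hW ?_ hB).trans ?_
    · refine ne_top_of_le_ne_top (b := (n : ℝ≥0∞) * volume (Icc (-(n : ℝ)) n)) ?_ ?_
      · simp [Real.volume_Icc, ENNReal.mul_eq_top]
      · rw [← setLIntegral_const, ← lintegral_indicator measurableSet_Icc]
        refine lintegral_mono fun y => ?_
        by_cases hy : y ∈ S n
        · simp only [indicator_of_mem hy, indicator_of_mem hy.1]
          exact hy.2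
        · simp [indicator_of_notMem hy]
    · gcongr
      exact indicator_le_self _ _ _
  have hlim : ∀ x, W x * ∫⁻ y in Iio x, f y * u y =
      ⨆ n, W x * ∫⁻ y in Iio x, (S n).indicator f y * u y := fun x => by
    rw [← ENNReal.mul_iSup, ← lintegral_iSup]
    · congr 2 with y
      rw [← ENNReal.iSup_mul]
      congr 1
      refine le_antisymm ?_ (iSup_le fun n => indicator_le_self _ _ _)
      obtain ⟨n, hn⟩ := mem_iUnion.1 (hSU.symm ▸ mem_univ y)
      exact (indicator_of_mem hn f).ge.trans (le_iSup (fun n => (S n).indicator f y) n)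
    · exact fun n => (hf.indicator (hSm n)).mul hu
    · intro m n hmn y
      dsimp only
      gcongr
      exact hSmono hmn
  have hmono : Monotone fun n x => (W x * ∫⁻ y in Iio x, (S n).indicator f y * u y) ^ q := by
    intro m n hmn x
    dsimp only
    gcongr with y
    exact hSmono hmn
  have hq' : ∀ x, (W x * ∫⁻ y in Iio x, f y * u y) ^ q =
      ⨆ n, (W x * ∫⁻ y in Iio x, (S n).indicator f y * u y) ^ q := fun x => by
    rw [hlim]
    exact (ENNReal.orderIsoRpow q hq0).map_iSup _
  simp only [hq']
  rw [lintegral_iSup _ hmono]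
  · exact iSup_le hbound
  · exact fun n => (hW.mul monotone_lintegral_Iio.measurable).pow_const q

/-- The weighted Hardy inequality for the dual operator. -/
theorem hardy_dual (hpp : p.HolderConjugate p') (hpq : p ≤ q) (hf : Measurable f)
    (hu : Measurable u) (hW : Measurable W) (hfu : ∀ y, f y * u y ≠ ⊤)
    (hB : ∀ t, (∫⁻ y in Ioi t, u y ^ p') ^ (1 / p') * (∫⁻ x in Iio t, W x ^ q) ^ (1 / q) ≤ B) :
    ∫⁻ x, (W x * ∫⁻ y in Ioi x, f y * u y) ^ q ≤ (4 * B) ^ q * (∫⁻ y, f y ^ p) ^ (q / p) := by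
  have hIoi : ∀ (g : ℝ → ℝ≥0∞) (t : ℝ), ∫⁻ y in Ioi t, g (-y) = ∫⁻ y in Iio (-t), g y :=
    fun g t => by
    rw [← (Measure.measurePreserving_neg volume).setLIntegral_comp_preimage_emb
      (MeasurableEquiv.neg ℝ).measurableEmbedding g (Iio (-t))]
    simp
  have hIio : ∀ (g : ℝ → ℝ≥0∞) (t : ℝ), ∫⁻ y in Iio t, g (-y) = ∫⁻ y in Ioi (-t), g y :=
    fun g t => by
    rw [← (Measure.measurePreserving_neg volume).setLIntegral_comp_preimage_emb
      (MeasurableEquiv.neg ℝ).measurableEmbedding g (Ioi (-t))]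
    simp
  have h := hardy (f := fun y => f (-y)) (u := fun y => u (-y)) (W := fun y => W (-y)) (B := B)
    hpp hpq (hf.comp measurable_neg) (hu.comp measurable_neg) (hW.comp measurable_neg)
    (fun y => hfu (-y)) fun t => by
      simpa only [hIoi (fun y => W y ^ q), hIio (fun y => u y ^ p')] using hB (-t)
  simp only [hIio (fun y => f y * u y)] at h
  rwa [lintegral_neg_eq_self (fun x => (W x * ∫⁻ y in Ioi x, f y * u y) ^ q),
    lintegral_neg_eq_self (fun x => f x ^ p)] at h

end Hardy

section Norms

lemma eN_eq_eLpNorm' (r : ℝ) (g : ℝ → ℝ) :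
    eN r g = eLpNorm' g r (volume.restrict (Ioi 0)) := by
  simp [eN, eLpNorm'_eq_lintegral_enorm, Real.enorm_eq_ofReal_abs]

lemma eN_eq_lintegral_enorm (r : ℝ) (g : ℝ → ℝ) :
    eN r g = (∫⁻ x in Ioi (0 : ℝ), ‖g x‖ₑ ^ r) ^ (1 / r) := by
  rw [eN_eq_eLpNorm', eLpNorm'_eq_lintegral_enorm]

lemma memLp_of_eN_le_one {r : ℝ} (hr : 0 < r) {g : ℝ → ℝ} (hgm : Measurable g) (hg : eN r g ≤ 1) :
    MemLp g (ENNReal.ofReal r) (volume.restrict (Ioi 0)) := by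
  refine ⟨hgm.aestronglyMeasurable, ?_⟩
  rw [eLpNorm_eq_eLpNorm' (by simpa using hr) ENNReal.ofReal_ne_top, ENNReal.toReal_ofReal hr.le,
    ← eN_eq_eLpNorm']
  exact hg.trans_lt ENNReal.one_lt_top

end Norms

/-- Bounded sequences in `L^p` have subsequences that converge weakly, tested against `L^{p'}`. -/
lemma exists_subseq_tendsto_integral_mul {p p' : ℝ} (hpp : p.HolderConjugate p')
    {f : ℕ → ℝ → ℝ} (hfm : ∀ n, Measurable (f n)) (hf : ∀ n, eN p (f n) ≤ 1) :
    ∃ φ : ℕ → ℕ, StrictMono φ ∧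
      ∀ g : ℝ → ℝ, MemLp g (ENNReal.ofReal p') (volume.restrict (Ioi 0)) →
        ∃ l, Tendsto (fun n => ∫ y in Ioi (0 : ℝ), f (φ n) y * g y) atTop (𝓝 l) := by
  set μ : Measure ℝ := volume.restrict (Ioi 0)
  have : ENNReal.HolderConjugate (ENNReal.ofReal p) (ENNReal.ofReal p') := hpp.ennrealOfReal
  have : Fact (1 ≤ ENNReal.ofReal p) := ⟨by simpa using hpp.lt.le⟩
  have : Fact (1 ≤ ENNReal.ofReal p') := ⟨by simpa using hpp.symm.lt.le⟩
  have : Fact (ENNReal.ofReal p' ≠ ⊤) := ⟨ENNReal.ofReal_ne_top⟩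
  let L := (ContinuousLinearMap.mul ℝ ℝ).lpPairing μ (ENNReal.ofReal p) (ENNReal.ofReal p')
  have hmem : ∀ n, MemLp (f n) (ENNReal.ofReal p) μ := fun n =>
    memLp_of_eN_le_one hpp.pos (hfm n) (hf n)
  have hnorm : ∀ n, ‖(hmem n).toLp‖ ≤ 1 := fun n => by
    rw [Lp.norm_toLp, eLpNorm_eq_eLpNorm' (by simpa using hpp.pos) ENNReal.ofReal_ne_top,
      ENNReal.toReal_ofReal hpp.pos.le, ← eN_eq_eLpNorm']
    exact ENNReal.toReal_le_of_le_ofReal zero_le_one (by simpa using hf n)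
  let Λ : ℕ → WeakDual ℝ (Lp ℝ (ENNReal.ofReal p') μ) := fun n =>
    StrongDual.toWeakDual (L (hmem n).toLp)
  have hΛ : ∀ n, Λ n ∈ WeakDual.toStrongDual ⁻¹' Metric.closedBall
      (0 : StrongDual ℝ (Lp ℝ (ENNReal.ofReal p') μ)) ‖L‖ := fun n => by
    rw [mem_preimage, mem_closedBall_zero_iff]
    exact (L.le_opNorm _).trans (mul_le_of_le_one_right (norm_nonneg _) (hnorm n))
  obtain ⟨Λ₀, -, φ, hφ, hlim⟩ := WeakDual.isSeqCompact_closedBall ℝ _ _ _ hΛ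
  refine ⟨φ, hφ, fun g hg => ⟨Λ₀ hg.toLp, ?_⟩⟩
  refine (((WeakDual.eval_continuous hg.toLp).tendsto Λ₀).comp hlim).congr fun n => ?_
  change L (hmem (φ n)).toLp hg.toLp = _
  rw [ContinuousLinearMap.lpPairing_eq_integral]
  refine integral_congr_ae ?_
  filter_upwards [(hmem (φ n)).coeFn_toLp, hg.coeFn_toLp] with y h1 h2
  simp [h1, h2]

section Kernel

/-- The Stieltjes kernel `1/(x^λ + y^λ)`. -/
def stieltjesKernel (lam x y : ℝ) : ℝ≥0∞ := ENNReal.ofReal (1 / (x ^ lam + y ^ lam))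

variable {lam x y : ℝ}

lemma stieltjesKernel_comm : stieltjesKernel lam x y = stieltjesKernel lam y x := by
  simp [stieltjesKernel, add_comm]

lemma measurable_stieltjesKernel :
    Measurable fun z : ℝ × ℝ => stieltjesKernel lam z.1 z.2 := by
  unfold stieltjesKernel
  fun_prop

lemma stieltjesKernel_le_left (hx : 0 < x) (hy : 0 < y) :
    stieltjesKernel lam x y ≤ ENNReal.ofReal x ^ (-lam) := by
  rw [stieltjesKernel, ENNReal.ofReal_rpow_of_pos hx, Real.rpow_neg hx.le, ← one_div]
  have := Real.rpow_pos_of_pos hx lam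
  have := Real.rpow_pos_of_pos hy lam
  gcongr
  linarith

lemma stieltjesKernel_le_right (hx : 0 < x) (hy : 0 < y) :
    stieltjesKernel lam x y ≤ ENNReal.ofReal y ^ (-lam) := by
  rw [stieltjesKernel_comm]
  exact stieltjesKernel_le_left hy hx

lemma enorm_stieltjes_integrand {f v : ℝ → ℝ} (hv : ∀ y, 0 ≤ v y) (hx : 0 < x) (hy : 0 < y) :
    ‖f y * v y / (x ^ lam + y ^ lam)‖ₑ =
      ‖f y‖ₑ * (ENNReal.ofReal (v y) * stieltjesKernel lam x y) := by
  have := Real.rpow_pos_of_pos hx lam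
  have := Real.rpow_pos_of_pos hy lam
  rw [stieltjesKernel, ← ENNReal.ofReal_mul (hv y), ← Real.enorm_eq_ofReal
    (mul_nonneg (hv y) (by positivity)), ← enorm_mul]
  congr 1
  ring

end Kernel

section Bounded

variable {lam p p' q : ℝ} {v w : ℝ → ℝ} {B : ℝ≥0∞}

lemma lintegral_indicator_rpow {I s : Set ℝ} (hI : MeasurableSet I) {r : ℝ} (hr : 0 < r)
    (g : ℝ → ℝ≥0∞) : ∫⁻ y in s, I.indicator g y ^ r = ∫⁻ y in I ∩ s, g y ^ r := by
  rw [← Measure.restrict_restrict hI, ← lintegral_indicator hI]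
  refine lintegral_congr fun y => ?_
  by_cases hy : y ∈ I <;> simp [hy, hr]

lemma mul_rpow_neg (hr : 0 < p) (z : ℝ≥0∞) (y : ℝ) :
    (z * ENNReal.ofReal y ^ (-lam)) ^ p = ENNReal.ofReal y ^ (-(lam * p)) * z ^ p := by
  rw [ENNReal.mul_rpow_of_nonneg _ _ hr.le, ← ENNReal.rpow_mul, mul_comm, neg_mul]

/-- The Stieltjes operator restricted to an interval `I` is bounded by the supremum of the
Hardy characteristics over `I`. -/
theorem stieltjes_bound (hpp : p.HolderConjugate p') (hpq : p ≤ q)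
    (hv : Measurable v) (hw : Measurable w) {I : Set ℝ} (hI : I ⊆ Ioi 0) (hIc : I.OrdConnected)
    (hB : ∀ t ∈ I, V0 p' v t ^ (1 / p') * Winf lam q w t ^ (1 / q) ≤ B)
    (hB' : ∀ t ∈ I, Vinf lam p' v t ^ (1 / p') * W0 q w t ^ (1 / q) ≤ B)
    {h : ℝ → ℝ≥0∞} (hh : Measurable h) (hfin : ∀ y, h y ≠ ⊤) :
    (∫⁻ x in I, (ENNReal.ofReal (w x) *
      ∫⁻ y in I, h y * (ENNReal.ofReal (v y) * stieltjesKernel lam x y)) ^ q) ^ (1 / q) ≤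
      8 * B * (∫⁻ y in Ioi 0, h y ^ p) ^ (1 / p) := by
  have hp0 := hpp.pos
  have hp'0 := hpp.symm.pos
  have hq0 : 0 < q := hp0.trans_le hpq
  have hIm : MeasurableSet I := hIc.measurableSet
  have hvm : Measurable fun y => ENNReal.ofReal (v y) := hv.ennreal_ofReal
  have hwm : Measurable fun y => ENNReal.ofReal (w y) := hw.ennreal_ofReal
  have hpow : Measurable fun y => ENNReal.ofReal y ^ (-lam) := by fun_prop
  let f := I.indicator h
  let u₁ := I.indicator fun y => ENNReal.ofReal (v y)
  let W₁ := I.indicator fun x => ENNReal.ofReal (w x) * ENNReal.ofReal x ^ (-lam)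
  let u₂ := I.indicator fun y => ENNReal.ofReal (v y) * ENNReal.ofReal y ^ (-lam)
  let W₂ := I.indicator fun x => ENNReal.ofReal (w x)
  have hf : Measurable f := hh.indicator hIm
  have hu₁ : Measurable u₁ := hvm.indicator hIm
  have hW₁ : Measurable W₁ := (hwm.mul hpow).indicator hIm
  have hu₂ : Measurable u₂ := (hvm.mul hpow).indicator hIm
  have hW₂ : Measurable W₂ := hwm.indicator hIm
  have hcases : ∀ t, t ∈ I ∨ I ∩ Iio t = ∅ ∨ I ∩ Ioi t = ∅ := fun t => by
    by_contra! hcon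
    obtain ⟨ht, ⟨a, ha, hat⟩, ⟨b, hb, hbt⟩⟩ := hcon
    exact ht (hIc.out ha hb ⟨le_of_lt hat, le_of_lt hbt⟩)
  have hsub : ∀ t, I ∩ Iio t ⊆ Ioo 0 t := fun t y hy => ⟨hI hy.1, hy.2⟩
  have hB₁ : ∀ t, (∫⁻ y in Iio t, u₁ y ^ p') ^ (1 / p') * (∫⁻ x in Ioi t, W₁ x ^ q) ^ (1 / q) ≤
      B := fun t => by
    simp only [u₁, W₁, lintegral_indicator_rpow hIm hp'0, lintegral_indicator_rpow hIm hq0,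
      mul_rpow_neg hq0]
    rcases hcases t with ht | ht | ht
    · refine le_trans ?_ (hB t ht)
      unfold V0 Winf
      gcongr
      · exact hsub t
      · exact inter_subset_right
    · simp [ht, hp'0]
    · simp [ht, hq0]
  have hB₂ : ∀ t, (∫⁻ y in Ioi t, u₂ y ^ p') ^ (1 / p') * (∫⁻ x in Iio t, W₂ x ^ q) ^ (1 / q) ≤
      B := fun t => by
    simp only [u₂, W₂, lintegral_indicator_rpow hIm hp'0, lintegral_indicator_rpow hIm hq0,
      mul_rpow_neg hp'0]
    rcases hcases t with ht | ht | ht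
    · refine le_trans ?_ (hB' t ht)
      unfold Vinf W0
      gcongr
      · exact inter_subset_right
      · exact hsub t
    · simp [ht, hq0]
    · simp [ht, hp'0]
  have hftop : ∀ y, f y ≠ ⊤ := fun y =>
    ne_top_of_le_ne_top (hfin y) (indicator_le_self _ _ _)
  have hu₂top : ∀ y, u₂ y ≠ ⊤ := fun y => by
    by_cases hy : y ∈ I
    · simp only [u₂, indicator_of_mem hy]
      rw [ENNReal.ofReal_rpow_of_pos (hI hy)]
      exact ENNReal.mul_ne_top ENNReal.ofReal_ne_top ENNReal.ofReal_ne_top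
    · simp [u₂, hy]
  have hu₁top : ∀ y, u₁ y ≠ ⊤ := fun y =>
    ne_top_of_le_ne_top ENNReal.ofReal_ne_top (indicator_le_self _ _ _)
  have H₁ := hardy hpp hpq hf hu₁ hW₁ (fun y => ENNReal.mul_ne_top (hftop y) (hu₁top y)) hB₁
  have H₂ := hardy_dual hpp hpq hf hu₂ hW₂ (fun y => ENNReal.mul_ne_top (hftop y) (hu₂top y)) hB₂
  have hfp : ∫⁻ y, f y ^ p ≤ ∫⁻ y in Ioi 0, h y ^ p := by
    rw [← setLIntegral_univ, lintegral_indicator_rpow hIm hp0, inter_univ]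
    exact lintegral_mono_set hI
  have hroot : ∀ z : ℝ≥0∞, z ≤ (4 * B) ^ q * (∫⁻ y, f y ^ p) ^ (q / p) →
      z ^ (1 / q) ≤ 4 * B * (∫⁻ y in Ioi 0, h y ^ p) ^ (1 / p) := fun z hz => by
    calc z ^ (1 / q) ≤ ((4 * B) ^ q * (∫⁻ y, f y ^ p) ^ (q / p)) ^ (1 / q) := by gcongr
      _ = 4 * B * (∫⁻ y, f y ^ p) ^ (1 / p) := by
        rw [ENNReal.mul_rpow_of_nonneg _ _ (by positivity), ← ENNReal.rpow_mul,
          ← ENNReal.rpow_mul, mul_one_div_cancel hq0.ne', ENNReal.rpow_one]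
        congr 2
        field_simp
      _ ≤ _ := by gcongr
  have hpt : ∀ x ∈ I, ENNReal.ofReal (w x) *
      ∫⁻ y in I, h y * (ENNReal.ofReal (v y) * stieltjesKernel lam x y) ≤
      W₁ x * (∫⁻ y in Iio x, f y * u₁ y) + W₂ x * ∫⁻ y in Ioi x, f y * u₂ y := by
    intro x hx
    have hx0 : 0 < x := hI hx
    simp only [W₁, W₂, indicator_of_mem hx, mul_assoc, ← mul_add]
    gcongr
    rw [← lintegral_const_mul _ (show Measurable fun y => f y * u₁ y from hf.mul hu₁)]
    have hsplit : I ⊆ (I ∩ Iio x) ∪ (I ∩ Ici x) := fun y hy =>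
      (lt_or_ge y x).imp (fun h => ⟨hy, h⟩) fun h => ⟨hy, h⟩
    refine (lintegral_mono_set hsplit).trans ((lintegral_union_le _ _ _).trans (add_le_add ?_ ?_))
    · calc _ ≤ ∫⁻ y in I ∩ Iio x, ENNReal.ofReal x ^ (-lam) * (f y * u₁ y) := by
            refine setLIntegral_mono' (hIm.inter measurableSet_Iio) fun y hy => ?_
            simp only [f, u₁, indicator_of_mem hy.1]
            rw [mul_comm (ENNReal.ofReal x ^ (-lam)), mul_assoc]
            gcongr
            exact stieltjesKernel_le_left hx0 (hI hy.1)
        _ ≤ _ := lintegral_mono_set inter_subset_right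
    · calc _ ≤ ∫⁻ y in I ∩ Ici x, f y * u₂ y := by
            refine setLIntegral_mono' (hIm.inter measurableSet_Ici) fun y hy => ?_
            simp only [f, u₂, indicator_of_mem hy.1]
            gcongr
            exact stieltjesKernel_le_right hx0 (hI hy.1)
        _ ≤ ∫⁻ y in Ici x, f y * u₂ y := lintegral_mono_set inter_subset_right
        _ = _ := setLIntegral_congr Ioi_ae_eq_Ici.symm
  have hanti : Antitone fun x => ∫⁻ y in Ioi x, f y * u₂ y := fun _ _ hxy =>
    lintegral_mono_set (Ioi_subset_Ioi hxy)
  calc _ ≤ (∫⁻ x in I, (W₁ x * (∫⁻ y in Iio x, f y * u₁ y) +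
        W₂ x * ∫⁻ y in Ioi x, f y * u₂ y) ^ q) ^ (1 / q) := by
        gcongr ?_ ^ _
        refine setLIntegral_mono' hIm fun x hx => ?_
        gcongr
        exact hpt x hx
    _ ≤ (∫⁻ x, (W₁ x * (∫⁻ y in Iio x, f y * u₁ y) +
        W₂ x * ∫⁻ y in Ioi x, f y * u₂ y) ^ q) ^ (1 / q) := by
        gcongr
        exact Measure.restrict_le_self
    _ ≤ (∫⁻ x, (W₁ x * (∫⁻ y in Iio x, f y * u₁ y)) ^ q) ^ (1 / q) +
        (∫⁻ x, (W₂ x * ∫⁻ y in Ioi x, f y * u₂ y) ^ q) ^ (1 / q) :=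
        ENNReal.lintegral_Lp_add_le (hW₁.mul monotone_lintegral_Iio.measurable).aemeasurable
          (hW₂.mul hanti.measurable).aemeasurable (hpp.lt.le.trans hpq)
    _ ≤ 4 * B * (∫⁻ y in Ioi 0, h y ^ p) ^ (1 / p) +
        4 * B * (∫⁻ y in Ioi 0, h y ^ p) ^ (1 / p) := add_le_add (hroot _ H₁) (hroot _ H₂)
    _ = _ := by ring

end Bounded

section LocalFiniteness

variable {lam r : ℝ} {u : ℝ → ℝ} {a b : ℝ}

lemma lintegral_Icc_rpow_ne_top (hr : 0 < r) (hupos : ∀ y, 0 ≤ u y)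
    (hloc : LocallyIntegrableOn (fun y => u y ^ r) (Ioi (0 : ℝ))) (ha : 0 < a) :
    ∫⁻ y in Icc a b, ENNReal.ofReal (u y) ^ r ≠ ⊤ := by
  have h := (hloc.integrableOn_compact_subset (t := Icc a b)
    (fun y hy => ha.trans_le hy.1) isCompact_Icc).lintegral_lt_top.ne
  simpa only [ENNReal.ofReal_rpow_of_nonneg (hupos _) hr.le] using h

lemma V0_le_add : V0 r u b ≤ V0 r u a + ∫⁻ y in Icc a b, ENNReal.ofReal (u y) ^ r := by
  refine (lintegral_mono_set fun y hy => ?_).trans (lintegral_union_le _ _ _)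
  exact (lt_or_ge y a).imp (fun h => ⟨hy.1, h⟩) fun h => ⟨h, hy.2.le⟩

lemma rpow_neg_mul_le (hlam : 0 < lam) (hr : 0 < r) {y : ℝ} (hy : a ≤ y) :
    ENNReal.ofReal y ^ (-(lam * r)) ≤ ENNReal.ofReal a ^ (-(lam * r)) := by
  rw [ENNReal.rpow_neg, ENNReal.rpow_neg]
  gcongr

lemma lintegral_Icc_rpow_neg_mul_ne_top (hlam : 0 < lam) (hr : 0 < r) (hum : Measurable u)
    (hupos : ∀ y, 0 ≤ u y) (hloc : LocallyIntegrableOn (fun y => u y ^ r) (Ioi (0 : ℝ)))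
    (ha : 0 < a) :
    ∫⁻ y in Icc a b, ENNReal.ofReal y ^ (-(lam * r)) * ENNReal.ofReal (u y) ^ r ≠ ⊤ := by
  refine ne_top_of_le_ne_top (ENNReal.mul_ne_top (a := ENNReal.ofReal a ^ (-(lam * r))) ?_
    (lintegral_Icc_rpow_ne_top (b := b) hr hupos hloc ha)) ?_
  · rw [ENNReal.ofReal_rpow_of_pos ha]
    exact ENNReal.ofReal_ne_top
  · rw [← lintegral_const_mul _ (hum.ennreal_ofReal.pow_const r)]
    refine setLIntegral_mono' measurableSet_Icc fun y hy => ?_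
    gcongr ?_ * _
    exact rpow_neg_mul_le hlam hr hy.1

lemma Vinf_le_add : Vinf lam r u a ≤ Vinf lam r u b +
    ∫⁻ y in Icc a b, ENNReal.ofReal y ^ (-(lam * r)) * ENNReal.ofReal (u y) ^ r := by
  refine (lintegral_mono_set fun y hy => ?_).trans (lintegral_union_le _ _ _)
  exact (lt_or_ge b y).imp (fun h => h) fun h => ⟨le_of_lt hy, h⟩

/-- Products of two extended non-negative quantities which change by finite amounts
stay finite when the factors are taken at different points. -/
lemma ENNReal.rpow_mul_rpow_ne_top_of_le_add {r s : ℝ} (hr : 0 < r) (hs : 0 < s)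
    {x x' y y' c d : ℝ≥0∞} (hx : x ≤ x' + c) (hc : c ≠ ⊤) (hy : y' ≤ y + d) (hd : d ≠ ⊤)
    (h : x ^ r * y ^ s ≠ ⊤) (h' : x' ^ r * y' ^ s ≠ ⊤) : x ^ r * y' ^ s ≠ ⊤ := by
  rcases eq_or_ne x ⊤ with rfl | hxt
  · have hx' : x' = ⊤ := by
      rcases ENNReal.add_eq_top.1 (top_le_iff.1 hx) with h | h
      exacts [h, absurd h hc]
    rwa [hx'] at h'
  rcases eq_or_ne y' ⊤ with rfl | hyt
  · have hy' : y = ⊤ := by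
      rcases ENNReal.add_eq_top.1 (top_le_iff.1 hy) with h | h
      exacts [h, absurd h hd]
    rwa [hy'] at h
  exact ENNReal.mul_ne_top (ENNReal.rpow_ne_top_of_nonneg hr.le hxt)
    (ENNReal.rpow_ne_top_of_nonneg hs.le hyt)

end LocalFiniteness

section OffDiagonal

/-- The part of the kernel `v(y)/(x^λ + y^λ)` off the corners `(0,a]²` and `[b,∞)²`. -/
def offKernel (lam a b : ℝ) (v : ℝ → ℝ) (x y : ℝ) : ℝ :=
  if (x ≤ a ∧ y ≤ a) ∨ (b ≤ x ∧ b ≤ y) then 0 else v y / (x ^ lam + y ^ lam)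

/-- The integral operator with kernel `w(x) * offKernel lam a b v x y`. -/
def offOp (lam a b : ℝ) (v w f : ℝ → ℝ) (x : ℝ) : ℝ :=
  w x * ∫ y in Ioi (0 : ℝ), f y * offKernel lam a b v x y

/-- The function `w(x) * ‖offKernel lam a b v x ·‖_{p'}`. -/
def offDom (lam p' a b : ℝ) (v w : ℝ → ℝ) (x : ℝ) : ℝ≥0∞ :=
  ENNReal.ofReal (w x) * (∫⁻ y in Ioi (0 : ℝ), ‖offKernel lam a b v x y‖ₑ ^ p') ^ (1 / p')

variable {lam p p' q a b : ℝ} {v w : ℝ → ℝ}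

lemma measurable_offKernel (hv : Measurable v) :
    Measurable fun z : ℝ × ℝ => offKernel lam a b v z.1 z.2 := by
  unfold offKernel
  refine Measurable.ite ?_ measurable_const (by fun_prop)
  refine MeasurableSet.union (MeasurableSet.inter ?_ ?_) (MeasurableSet.inter ?_ ?_)
  · exact measurableSet_le measurable_fst measurable_const
  · exact measurableSet_le measurable_snd measurable_const
  · exact measurableSet_le measurable_const measurable_fst
  · exact measurableSet_le measurable_const measurable_snd

lemma measurable_offOp (hv : Measurable v) (hw : Measurable w) {f : ℝ → ℝ} (hf : Measurable f) :
    Measurable (offOp lam a b v w f) := by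
  refine hw.mul (StronglyMeasurable.integral_prod_right
    (f := fun x y => f y * offKernel lam a b v x y) ?_).measurable
  exact ((hf.comp measurable_snd).mul (measurable_offKernel hv)).stronglyMeasurable

lemma measurable_offDom (hv : Measurable v) (hw : Measurable w) :
    Measurable (offDom lam p' a b v w) := by
  refine hw.ennreal_ofReal.mul (Measurable.pow_const ?_ _)
  exact Measurable.lintegral_prod_right' (f := fun z : ℝ × ℝ => ‖offKernel lam a b v z.1 z.2‖ₑ ^ p')
    ((measurable_offKernel hv).enorm.pow_const p')

lemma enorm_offOp_le (hpp : p.HolderConjugate p') (hv : Measurable v) (hwpos : ∀ x, 0 ≤ w x)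
    {f : ℝ → ℝ} (hfm : Measurable f) (hf : eN p f ≤ 1) (x : ℝ) :
    ‖offOp lam a b v w f x‖ₑ ≤ offDom lam p' a b v w x := by
  rw [offOp, offDom, enorm_mul, Real.enorm_eq_ofReal (hwpos x)]
  gcongr
  refine (enorm_integral_le_lintegral_enorm _).trans ?_
  simp only [enorm_mul]
  have hk : Measurable (offKernel lam a b v x) :=
    (measurable_offKernel hv).comp measurable_prodMk_left
  refine (ENNReal.lintegral_mul_le_Lp_mul_Lq _ hpp hfm.enorm.aemeasurable
    hk.enorm.aemeasurable).trans ?_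
  rw [← eN_eq_lintegral_enorm]
  exact mul_le_of_le_one_left' hf

lemma lintegral_const_mul_rpow_rpow {α : Type*} [MeasurableSpace α] {μ : Measure α} {r : ℝ}
    (hr : 0 < r) (c : ℝ≥0∞) {g : α → ℝ≥0∞} (hg : Measurable g) :
    (∫⁻ y, (c * g y) ^ r ∂μ) ^ (1 / r) = c * (∫⁻ y, g y ^ r ∂μ) ^ (1 / r) := by
  simp only [ENNReal.mul_rpow_of_nonneg _ _ hr.le]
  rw [lintegral_const_mul _ (hg.pow_const r), ENNReal.mul_rpow_of_nonneg _ _ (by positivity),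
    ← ENNReal.rpow_mul, mul_one_div_cancel hr.ne', ENNReal.rpow_one]

lemma enorm_offKernel_le (hvpos : ∀ y, 0 ≤ v y) (hab : a < b) {x y : ℝ} (hx : 0 < x)
    (hy : 0 < y) :
    ‖offKernel lam a b v x y‖ₑ ≤
      (Iio b).indicator 1 x *
          (Ioi a).indicator (fun y => ENNReal.ofReal (v y) * ENNReal.ofReal y ^ (-lam)) y +
        (Ioi a).indicator (fun x => ENNReal.ofReal x ^ (-lam)) x *
          (Iio b).indicator (fun y => ENNReal.ofReal (v y)) y := by
  unfold offKernel
  split_ifs with h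
  · simp
  have hk : ‖v y / (x ^ lam + y ^ lam)‖ₑ = ENNReal.ofReal (v y) * stieltjesKernel lam x y := by
    simpa using enorm_stieltjes_integrand (f := 1) (lam := lam) hvpos hx hy
  rw [hk]
  push Not at h
  rcases lt_or_ge a y with hay | hay
  · rcases lt_or_ge x b with hxb | hxb
    · refine le_trans ?_ le_self_add
      rw [indicator_of_mem (show x ∈ Iio b from hxb), indicator_of_mem (show y ∈ Ioi a from hay),
        Pi.one_apply, one_mul]
      gcongr
      exact stieltjesKernel_le_right hx hy
    · refine le_trans ?_ le_add_self
      rw [indicator_of_mem (show x ∈ Ioi a from hab.trans_le hxb),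
        indicator_of_mem (show y ∈ Iio b from h.2 hxb), mul_comm]
      gcongr
      exact stieltjesKernel_le_left hx hy
  · refine le_trans ?_ le_add_self
    have hxa : a < x := lt_of_not_ge fun h' => (h.1 h').not_ge hay
    rw [indicator_of_mem (show x ∈ Ioi a from hxa),
      indicator_of_mem (show y ∈ Iio b from hay.trans_lt hab), mul_comm]
    gcongr
    exact stieltjesKernel_le_left hx hy

lemma offDom_le (hpp : p.HolderConjugate p') (hv : Measurable v) (hvpos : ∀ y, 0 ≤ v y)
    (ha : 0 < a) (hab : a < b) {x : ℝ} (hx : 0 < x) :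
    offDom lam p' a b v w x ≤
      Vinf lam p' v a ^ (1 / p') * (Iio b).indicator (fun x => ENNReal.ofReal (w x)) x +
      V0 p' v b ^ (1 / p') *
        (Ioi a).indicator (fun x => ENNReal.ofReal (w x) * ENNReal.ofReal x ^ (-lam)) x := by
  have hp' := hpp.symm.pos
  have hvm : Measurable fun y => ENNReal.ofReal (v y) := hv.ennreal_ofReal
  have hpow : Measurable fun y => ENNReal.ofReal y ^ (-lam) := by fun_prop
  have hm₁ : Measurable
      ((Ioi a).indicator fun y => ENNReal.ofReal (v y) * ENNReal.ofReal y ^ (-lam)) :=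
    (hvm.mul hpow).indicator measurableSet_Ioi
  have hm₂ : Measurable ((Iio b).indicator fun y => ENNReal.ofReal (v y)) :=
    hvm.indicator measurableSet_Iio
  have hV : ∫⁻ y in Ioi 0, (Ioi a).indicator
      (fun y => ENNReal.ofReal (v y) * ENNReal.ofReal y ^ (-lam)) y ^ p' = Vinf lam p' v a := by
    rw [lintegral_indicator_rpow measurableSet_Ioi hp',
      inter_eq_left.2 (Ioi_subset_Ioi ha.le)]
    simp only [mul_rpow_neg hp', Vinf]
  have hV' : ∫⁻ y in Ioi 0, (Iio b).indicator (fun y => ENNReal.ofReal (v y)) y ^ p' =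
      V0 p' v b := by
    rw [lintegral_indicator_rpow measurableSet_Iio hp', inter_comm, Ioi_inter_Iio, V0]
  have hnorm : (∫⁻ y in Ioi (0 : ℝ), ‖offKernel lam a b v x y‖ₑ ^ p') ^ (1 / p') ≤
      (Iio b).indicator 1 x * Vinf lam p' v a ^ (1 / p') +
      (Ioi a).indicator (fun x => ENNReal.ofReal x ^ (-lam)) x * V0 p' v b ^ (1 / p') := by
    calc _ ≤ (∫⁻ y in Ioi (0 : ℝ), ((Iio b).indicator 1 x *
          (Ioi a).indicator (fun y => ENNReal.ofReal (v y) * ENNReal.ofReal y ^ (-lam)) y +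
        (Ioi a).indicator (fun x => ENNReal.ofReal x ^ (-lam)) x *
          (Iio b).indicator (fun y => ENNReal.ofReal (v y)) y) ^ p') ^ (1 / p') := by
          gcongr ?_ ^ _
          refine setLIntegral_mono' measurableSet_Ioi fun y hy => ?_
          exact ENNReal.rpow_le_rpow (enorm_offKernel_le hvpos hab hx hy) hp'.le
      _ ≤ _ := ENNReal.lintegral_Lp_add_le (hm₁.const_mul _).aemeasurable
          (hm₂.const_mul _).aemeasurable hpp.symm.lt.le
      _ = _ := by
          rw [lintegral_const_mul_rpow_rpow hp' _ hm₁, lintegral_const_mul_rpow_rpow hp' _ hm₂,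
            hV, hV']
  calc offDom lam p' a b v w x ≤ ENNReal.ofReal (w x) *
        ((Iio b).indicator 1 x * Vinf lam p' v a ^ (1 / p') +
        (Ioi a).indicator (fun x => ENNReal.ofReal x ^ (-lam)) x * V0 p' v b ^ (1 / p')) := by
        rw [offDom]
        gcongr
    _ = _ := by
        rw [mul_add]
        congr 1
        · by_cases hxb : x < b <;> simp [hxb, mul_comm]
        · by_cases hxa : a < x
          · simp [hxa]
            ring
          · simp [hxa]

lemma lintegral_offDom_rpow_ne_top (hpp : p.HolderConjugate p') (hpq : p ≤ q)
    (hv : Measurable v) (hw : Measurable w) (hvpos : ∀ y, 0 ≤ v y)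
    (ha : 0 < a) (hab : a < b)
    (h₁ : V0 p' v b ^ (1 / p') * Winf lam q w a ^ (1 / q) ≠ ⊤)
    (h₂ : Vinf lam p' v a ^ (1 / p') * W0 q w b ^ (1 / q) ≠ ⊤) :
    ∫⁻ x in Ioi (0 : ℝ), offDom lam p' a b v w x ^ q ≠ ⊤ := by
  have hq0 : 0 < q := hpp.pos.trans_le hpq
  have hwm : Measurable fun y => ENNReal.ofReal (w y) := hw.ennreal_ofReal
  have hpow : Measurable fun y => ENNReal.ofReal y ^ (-lam) := by fun_prop
  have hm₁ : Measurable
      ((Ioi a).indicator fun y => ENNReal.ofReal (w y) * ENNReal.ofReal y ^ (-lam)) :=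
    (hwm.mul hpow).indicator measurableSet_Ioi
  have hm₂ : Measurable ((Iio b).indicator fun y => ENNReal.ofReal (w y)) :=
    hwm.indicator measurableSet_Iio
  have hW : ∫⁻ y in Ioi 0, (Ioi a).indicator
      (fun y => ENNReal.ofReal (w y) * ENNReal.ofReal y ^ (-lam)) y ^ q = Winf lam q w a := by
    rw [lintegral_indicator_rpow measurableSet_Ioi hq0, inter_eq_left.2 (Ioi_subset_Ioi ha.le)]
    simp only [mul_rpow_neg hq0, Winf]
  have hW' : ∫⁻ y in Ioi 0, (Iio b).indicator (fun y => ENNReal.ofReal (w y)) y ^ q =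
      W0 q w b := by
    rw [lintegral_indicator_rpow measurableSet_Iio hq0, inter_comm, Ioi_inter_Iio, W0]
  suffices h : (∫⁻ x in Ioi (0 : ℝ), offDom lam p' a b v w x ^ q) ^ (1 / q) ≠ ⊤ by
    intro htop
    exact h (by simp [htop, hq0])
  refine ne_top_of_le_ne_top (ENNReal.add_ne_top.2 ⟨h₂, h₁⟩) ?_
  calc _ ≤ (∫⁻ x in Ioi (0 : ℝ),
        (Vinf lam p' v a ^ (1 / p') * (Iio b).indicator (fun x => ENNReal.ofReal (w x)) x +
        V0 p' v b ^ (1 / p') * (Ioi a).indicator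
          (fun x => ENNReal.ofReal (w x) * ENNReal.ofReal x ^ (-lam)) x) ^ q) ^ (1 / q) := by
        gcongr ?_ ^ _
        refine setLIntegral_mono' measurableSet_Ioi fun y hy => ?_
        exact ENNReal.rpow_le_rpow (offDom_le hpp hv hvpos ha hab hy) hq0.le
    _ ≤ _ := ENNReal.lintegral_Lp_add_le (hm₂.const_mul _).aemeasurable
        (hm₁.const_mul _).aemeasurable (hpp.lt.le.trans hpq)
    _ = _ := by
        rw [lintegral_const_mul_rpow_rpow hq0 _ hm₁, lintegral_const_mul_rpow_rpow hq0 _ hm₂,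
          hW, hW']

/-- The operator with kernel off the corners maps weakly convergent sequences to Cauchy ones. -/
lemma tendsto_lintegral_offOp_sub (hpp : p.HolderConjugate p') (hpq : p ≤ q)
    (hv : Measurable v) (hw : Measurable w) (hwpos : ∀ x, 0 ≤ w x)
    (hD : ∫⁻ x in Ioi (0 : ℝ), offDom lam p' a b v w x ^ q ≠ ⊤)
    {f : ℕ → ℝ → ℝ} (hfm : ∀ n, Measurable (f n)) (hf : ∀ n, eN p (f n) ≤ 1)
    (hlim : ∀ g : ℝ → ℝ, MemLp g (ENNReal.ofReal p') (volume.restrict (Ioi 0)) →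
      ∃ l, Tendsto (fun n => ∫ y in Ioi (0 : ℝ), f n y * g y) atTop (𝓝 l)) :
    Tendsto (fun mn : ℕ × ℕ => ∫⁻ x in Ioi (0 : ℝ),
      ‖offOp lam a b v w (f mn.1) x - offOp lam a b v w (f mn.2) x‖ₑ ^ q) atTop (𝓝 0) := by
  have hp' := hpp.symm.pos
  have hq0 : 0 < q := hpp.pos.trans_le hpq
  have hDm : Measurable (offDom lam p' a b v w) := measurable_offDom hv hw
  rw [← lintegral_zero (μ := volume.restrict (Ioi (0 : ℝ)))]
  refine tendsto_lintegral_filter_of_dominated_convergence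
    (fun x => (2 * offDom lam p' a b v w x) ^ q) ?_ ?_ ?_ ?_
  · exact .of_forall fun mn =>
      ((measurable_offOp hv hw (hfm _)).sub (measurable_offOp hv hw (hfm _))).enorm.pow_const q
  · refine .of_forall fun mn => .of_forall fun x => ?_
    gcongr
    rw [two_mul]
    exact enorm_sub_le.trans (add_le_add (enorm_offOp_le hpp hv hwpos (hfm _) (hf _) x)
      (enorm_offOp_le hpp hv hwpos (hfm _) (hf _) x))
  · simp only [ENNReal.mul_rpow_of_nonneg _ _ hq0.le]
    rw [lintegral_const_mul _ (hDm.pow_const q)]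
    exact ENNReal.mul_ne_top (ENNReal.rpow_ne_top_of_nonneg hq0.le ENNReal.ofNat_ne_top) hD
  · filter_upwards [ae_lt_top (hDm.pow_const q) hD] with x hx
    have hx' : offDom lam p' a b v w x < ⊤ := (ENNReal.rpow_lt_top_iff_of_pos hq0).1 hx
    suffices h : ∃ l, Tendsto (fun n => offOp lam a b v w (f n) x) atTop (𝓝 l) by
      obtain ⟨l, hl⟩ := h
      have h1 := (hl.comp (tendsto_fst (f := atTop (α := ℕ)) (g := atTop (α := ℕ)))).sub
        (hl.comp (tendsto_snd (f := atTop (α := ℕ)) (g := atTop (α := ℕ))))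
      rw [prod_atTop_atTop_eq, sub_self] at h1
      have h2 := (ENNReal.continuous_rpow_const (y := q)).tendsto _ |>.comp h1.enorm
      simpa [hq0, Function.comp_def] using h2
    by_cases hwx : w x = 0
    · exact ⟨0, by simp [offOp, hwx]⟩
    · have hk : Measurable (offKernel lam a b v x) :=
        (measurable_offKernel hv).comp measurable_prodMk_left
      obtain ⟨l, hl⟩ := hlim (offKernel lam a b v x) ⟨hk.aestronglyMeasurable, by
        rw [eLpNorm_eq_eLpNorm' (by simpa using hp') ENNReal.ofReal_ne_top,
          ENNReal.toReal_ofReal hp'.le, eLpNorm'_eq_lintegral_enorm]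
        refine ENNReal.lt_top_of_mul_ne_top_right hx'.ne ?_
        simpa using lt_of_le_of_ne (hwpos x) (Ne.symm hwx)⟩
      exact ⟨w x * l, hl.const_mul _⟩

end OffDiagonal

section Sufficiency

variable {lam p p' q a b : ℝ} {v w : ℝ → ℝ}

/-- The positive operator with Stieltjes kernel on the square `I × I`. -/
def stieltjesOn (lam : ℝ) (v w : ℝ → ℝ) (I : Set ℝ) (h : ℝ → ℝ≥0∞) : ℝ → ℝ≥0∞ :=
  I.indicator fun x => ENNReal.ofReal (w x) *
    ∫⁻ y in I, h y * (ENNReal.ofReal (v y) * stieltjesKernel lam x y)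

lemma measurable_stieltjesOn (hv : Measurable v) (hw : Measurable w) {I : Set ℝ}
    (hI : MeasurableSet I) {h : ℝ → ℝ≥0∞} (hh : Measurable h) :
    Measurable (stieltjesOn lam v w I h) := by
  refine Measurable.indicator (hw.ennreal_ofReal.mul ?_) hI
  exact Measurable.lintegral_prod_right'
    (f := fun z : ℝ × ℝ => h z.2 * (ENNReal.ofReal (v z.2) * stieltjesKernel lam z.1 z.2))
    ((hh.comp measurable_snd).mul
      ((hv.comp measurable_snd).ennreal_ofReal.mul measurable_stieltjesKernel))

lemma lintegral_stieltjesOn_le (hpp : p.HolderConjugate p') (hpq : p ≤ q)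
    (hv : Measurable v) (hw : Measurable w) {I : Set ℝ} (hI : I ⊆ Ioi 0) (hIc : I.OrdConnected)
    {B : ℝ≥0∞}
    (hB : ∀ t ∈ I, V0 p' v t ^ (1 / p') * Winf lam q w t ^ (1 / q) +
      Vinf lam p' v t ^ (1 / p') * W0 q w t ^ (1 / q) ≤ B)
    {f : ℝ → ℝ} (hf : Measurable f) :
    (∫⁻ x in Ioi 0, stieltjesOn lam v w I (fun y => ‖f y‖ₑ) x ^ q) ^ (1 / q) ≤
      8 * B * eN p f := by
  have hq0 : 0 < q := hpp.pos.trans_le hpq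
  have h := stieltjes_bound hpp hpq hv hw hI hIc (fun t ht => le_self_add.trans (hB t ht))
    (fun t ht => le_add_self.trans (hB t ht)) hf.enorm (fun y => enorm_ne_top)
  rw [eN_eq_lintegral_enorm]
  simp only [stieltjesOn]
  rwa [lintegral_indicator_rpow hIc.measurableSet hq0, inter_eq_left.2 hI]

lemma ae_integrable_or_eq_zero (hpp : p.HolderConjugate p') (hpq : p ≤ q)
    (hv : Measurable v) (hw : Measurable w) (hvpos : ∀ y, 0 ≤ v y) (hwpos : ∀ x, 0 ≤ w x)
    {B : ℝ≥0∞} (hBtop : B ≠ ⊤)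
    (hB : ∀ t ∈ Ioi (0 : ℝ), V0 p' v t ^ (1 / p') * Winf lam q w t ^ (1 / q) +
      Vinf lam p' v t ^ (1 / p') * W0 q w t ^ (1 / q) ≤ B)
    {f : ℝ → ℝ} (hfm : Measurable f) (hf : eN p f ≤ 1) :
    ∀ᵐ x ∂volume.restrict (Ioi (0 : ℝ)),
      w x = 0 ∨ IntegrableOn (fun y => f y * v y / (x ^ lam + y ^ lam)) (Ioi 0) := by
  have hq0 : 0 < q := hpp.pos.trans_le hpq
  have h := lintegral_stieltjesOn_le hpp hpq hv hw subset_rfl ordConnected_Ioi hB hfm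
  have hm := measurable_stieltjesOn (lam := lam) hv hw measurableSet_Ioi (I := Ioi 0) hfm.enorm
  have hfin : ∫⁻ x in Ioi 0, stieltjesOn lam v w (Ioi 0) (fun y => ‖f y‖ₑ) x ^ q ≠ ⊤ := by
    intro htop
    rw [htop, ENNReal.top_rpow_of_pos (by positivity), top_le_iff] at h
    exact ENNReal.mul_ne_top (ENNReal.mul_ne_top ENNReal.ofNat_ne_top hBtop)
      (hf.trans_lt ENNReal.one_lt_top).ne h
  filter_upwards [ae_lt_top (hm.pow_const q) hfin, ae_restrict_mem measurableSet_Ioi] with x hx hx0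
  refine or_iff_not_imp_left.2 fun hwx =>
    ⟨(show Measurable fun y => f y * v y / (x ^ lam + y ^ lam) by fun_prop).aestronglyMeasurable,
      ?_⟩
  rw [ENNReal.rpow_lt_top_iff_of_pos hq0, stieltjesOn, indicator_of_mem hx0] at hx
  have hlt := ENNReal.lt_top_of_mul_ne_top_right hx.ne
    (by simpa using lt_of_le_of_ne (hwpos x) (Ne.symm hwx))
  refine lt_of_eq_of_lt (setLIntegral_congr_fun measurableSet_Ioi fun y hy => ?_) hlt
  exact enorm_stieltjes_integrand hvpos hx0 hy

lemma enorm_SOp_sub_le (hvpos : ∀ y, 0 ≤ v y) (hv : Measurable v) (hwpos : ∀ x, 0 ≤ w x)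
    (ha : 0 < a) (hab : a < b) {f g : ℝ → ℝ} (hf : Measurable f) (hg : Measurable g)
    {x : ℝ} (hx : 0 < x)
    (hfi : w x = 0 ∨ IntegrableOn (fun y => f y * v y / (x ^ lam + y ^ lam)) (Ioi 0))
    (hgi : w x = 0 ∨ IntegrableOn (fun y => g y * v y / (x ^ lam + y ^ lam)) (Ioi 0)) :
    ‖SOp lam v w f x - SOp lam v w g x‖ₑ ≤
      ‖offOp lam a b v w f x - offOp lam a b v w g x‖ₑ +
      (stieltjesOn lam v w (Ioc 0 a) (fun y => ‖(f - g) y‖ₑ) x +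
        stieltjesOn lam v w (Ici b) (fun y => ‖(f - g) y‖ₑ) x) := by
  by_cases hwx : w x = 0
  · simp [SOp, hwx]
  replace hfi := hfi.resolve_left hwx
  replace hgi := hgi.resolve_left hwx
  have hk : Measurable (offKernel lam a b v x) :=
    (measurable_offKernel hv).comp measurable_prodMk_left
  have hoff : ∀ {f : ℝ → ℝ}, Measurable f →
      IntegrableOn (fun y => f y * v y / (x ^ lam + y ^ lam)) (Ioi 0) →
      IntegrableOn (fun y => f y * offKernel lam a b v x y) (Ioi 0) := fun {f} hf hfi => by
    refine Integrable.mono hfi (hf.mul hk).aestronglyMeasurable (.of_forall fun y => ?_)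
    unfold offKernel
    split_ifs
    · rw [mul_zero, norm_zero]
      exact norm_nonneg _
    · rw [mul_div_assoc]
  have heq : SOp lam v w f x - SOp lam v w g x =
      (offOp lam a b v w f x - offOp lam a b v w g x) +
      w x * ∫ y in Ioi 0, (f - g) y * (v y / (x ^ lam + y ^ lam) - offKernel lam a b v x y) := by
    have hsplit : ∀ y, (f - g) y * (v y / (x ^ lam + y ^ lam) - offKernel lam a b v x y) =
        (f y * v y / (x ^ lam + y ^ lam) - g y * v y / (x ^ lam + y ^ lam)) -
        (f y * offKernel lam a b v x y - g y * offKernel lam a b v x y) := fun y => by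
      rw [Pi.sub_apply]
      ring
    simp only [hsplit, SOp, offOp]
    have hi₁ : IntegrableOn (fun y => f y * v y / (x ^ lam + y ^ lam) -
        g y * v y / (x ^ lam + y ^ lam)) (Ioi 0) := hfi.sub hgi
    have hi₂ : IntegrableOn (fun y => f y * offKernel lam a b v x y -
        g y * offKernel lam a b v x y) (Ioi 0) := (hoff hf hfi).sub (hoff hg hgi)
    rw [integral_sub hi₁ hi₂, integral_sub hfi hgi,
      integral_sub (hoff hf hfi) (hoff hg hgi)]
    ring
  rw [heq]
  refine (enorm_add_le _ _).trans ?_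
  gcongr
  rw [enorm_mul, Real.enorm_eq_ofReal (hwpos x)]
  have hpt : ∀ y ∈ Ioi (0 : ℝ),
      ‖(f - g) y * (v y / (x ^ lam + y ^ lam) - offKernel lam a b v x y)‖ₑ =
      {y | (x ≤ a ∧ y ≤ a) ∨ (b ≤ x ∧ b ≤ y)}.indicator
        (fun y => ‖(f - g) y‖ₑ * (ENNReal.ofReal (v y) * stieltjesKernel lam x y)) y := by
    intro y hy
    unfold offKernel
    by_cases h : (x ≤ a ∧ y ≤ a) ∨ (b ≤ x ∧ b ≤ y)
    · rw [if_pos h, indicator_of_mem (by exact h), sub_zero, ← mul_div_assoc,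
        enorm_stieltjes_integrand hvpos hx hy]
    · rw [if_neg h, indicator_of_notMem (by exact h), sub_self, mul_zero, enorm_zero]
  calc ENNReal.ofReal (w x) * ‖∫ y in Ioi 0,
        (f - g) y * (v y / (x ^ lam + y ^ lam) - offKernel lam a b v x y)‖ₑ
      ≤ ENNReal.ofReal (w x) * ∫⁻ y in Ioi 0, {y | (x ≤ a ∧ y ≤ a) ∨ (b ≤ x ∧ b ≤ y)}.indicator
        (fun y => ‖(f - g) y‖ₑ * (ENNReal.ofReal (v y) * stieltjesKernel lam x y)) y := by
        gcongr
        refine (enorm_integral_le_lintegral_enorm _).trans_eq ?_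
        exact setLIntegral_congr_fun measurableSet_Ioi hpt
    _ ≤ _ := by
        rcases le_or_gt x a with hxa | hxa
        · refine le_trans ?_ le_self_add
          rw [stieltjesOn, indicator_of_mem (show x ∈ Ioc 0 a from ⟨hx, hxa⟩)]
          have hset : {y | (x ≤ a ∧ y ≤ a) ∨ (b ≤ x ∧ b ≤ y)} = Iic a := by
            ext y
            simp [hxa, (hxa.trans_lt hab).not_ge]
          rw [hset, lintegral_indicator measurableSet_Iic,
            Measure.restrict_restrict measurableSet_Iic, inter_comm, Ioi_inter_Iic]
        rcases le_or_gt b x with hbx | hbx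
        · refine le_trans ?_ le_add_self
          rw [stieltjesOn, indicator_of_mem (show x ∈ Ici b from hbx)]
          have hset : {y | (x ≤ a ∧ y ≤ a) ∨ (b ≤ x ∧ b ≤ y)} = Ici b := by
            ext y
            simp [hxa.not_ge, hbx]
          rw [hset, lintegral_indicator measurableSet_Ici,
            Measure.restrict_restrict measurableSet_Ici,
            inter_eq_left.2 (show Ici b ⊆ Ioi 0 from fun y hy => (ha.trans hab).trans_le hy)]
        · simp [hxa.not_ge, hbx.not_ge]

theorem SCompact_of_tendsto (hlam : 0 < lam) (hpp : p.HolderConjugate p') (hpq : p ≤ q)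
    (hv : Measurable v) (hw : Measurable w) (hvpos : ∀ y, 0 ≤ v y) (hwpos : ∀ x, 0 ≤ w x)
    (hlocv : LocallyIntegrableOn (fun y => v y ^ p') (Ioi (0 : ℝ)))
    (hlocw : LocallyIntegrableOn (fun x => w x ^ q) (Ioi (0 : ℝ)))
    {A : ℝ → ℝ≥0∞}
    (hA : A = fun t => V0 p' v t ^ (1 / p') * Winf lam q w t ^ (1 / q) +
      Vinf lam p' v t ^ (1 / p') * W0 q w t ^ (1 / q))
    (hsup : ⨆ t ∈ Ioi (0 : ℝ), A t < ⊤) (h0 : Tendsto A (𝓝[>] 0) (𝓝 0))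
    (hinf : Tendsto A atTop (𝓝 0)) : SCompact lam p q v w := by
  intro f hfm hf
  have hp' := hpp.symm.pos
  have hq0 : 0 < q := hpp.pos.trans_le hpq
  have hq1 : 1 ≤ q := hpp.lt.le.trans hpq
  have hAtop : ∀ t ∈ Ioi (0 : ℝ), A t ≤ ⨆ t ∈ Ioi (0 : ℝ), A t := fun t ht =>
    le_iSup₂ (f := fun t (_ : t ∈ Ioi (0 : ℝ)) => A t) t ht
  obtain ⟨φ, hφ, hlim⟩ := exists_subseq_tendsto_integral_mul hpp hfm hf
  refine ⟨φ, hφ, fun ε hε => ?_⟩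
  set B : ℝ≥0∞ := ENNReal.ofReal (ε / 128) with hBdef
  have hBpos : 0 < B := by simpa [B] using by positivity
  obtain ⟨a, ha, haB⟩ : ∃ a > 0, ∀ t ∈ Ioc 0 a, A t ≤ B := by
    obtain ⟨c, hc, hcB⟩ := mem_nhdsGT_iff_exists_Ioc_subset.1 (h0.eventually_le_const hBpos)
    exact ⟨c, hc, fun t ht => hcB ht⟩
  obtain ⟨b, hab, hbB⟩ : ∃ b > a, ∀ t ∈ Ici b, A t ≤ B := by
    obtain ⟨c, hc⟩ := eventually_atTop.1 (hinf.eventually_le_const hBpos)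
    exact ⟨max c (a + 1), lt_max_of_lt_right (by linarith), fun t ht => hc t (le_of_max_le_left ht)⟩
  have hb : 0 < b := ha.trans hab
  have hfin : ∀ t ∈ Ioi (0 : ℝ), V0 p' v t ^ (1 / p') * Winf lam q w t ^ (1 / q) ≠ ⊤ ∧
      Vinf lam p' v t ^ (1 / p') * W0 q w t ^ (1 / q) ≠ ⊤ := fun t ht => by
    have h := ((hAtop t ht).trans_lt hsup).ne
    rwa [hA, Ne, ENNReal.add_eq_top, not_or] at h
  have hD := lintegral_offDom_rpow_ne_top (lam := lam) hpp hpq hv hw hvpos ha hab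
    (ENNReal.rpow_mul_rpow_ne_top_of_le_add (by positivity) (by positivity)
      (V0_le_add (a := a)) (lintegral_Icc_rpow_ne_top hp' hvpos hlocv ha)
      (Vinf_le_add (b := b)) (lintegral_Icc_rpow_neg_mul_ne_top hlam hq0 hw hwpos hlocw ha)
      (hfin b hb).1 (hfin a ha).1)
    (ENNReal.rpow_mul_rpow_ne_top_of_le_add (by positivity) (by positivity)
      (Vinf_le_add (b := b)) (lintegral_Icc_rpow_neg_mul_ne_top hlam hp' hv hvpos hlocv ha)
      (V0_le_add (a := a)) (lintegral_Icc_rpow_ne_top hq0 hwpos hlocw ha)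
      (hfin a ha).2 (hfin b hb).2)
  have hR := tendsto_lintegral_offOp_sub hpp hpq hv hw hwpos hD (fun n => hfm (φ n))
    (fun n => hf (φ n)) hlim
  have hR' := ((ENNReal.continuous_rpow_const (y := 1 / q)).tendsto _).comp hR
  rw [ENNReal.zero_rpow_of_pos (by positivity)] at hR'
  obtain ⟨⟨N₁, N₂⟩, hN⟩ := eventually_atTop.1
    (hR'.eventually_le_const (show 0 < ENNReal.ofReal (ε / 4) by simpa using by positivity))
  refine ⟨max N₁ N₂, fun m hm n hn => ?_⟩
  have hmn := hN (m, n) ⟨le_of_max_le_left hm, le_of_max_le_right hn⟩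
  have hsub : eN p (f (φ m) - f (φ n)) ≤ 2 := by
    rw [eN_eq_eLpNorm', sub_eq_add_neg]
    refine (eLpNorm'_add_le (hfm _).aestronglyMeasurable (hfm _).neg.aestronglyMeasurable
      hpp.lt.le).trans ?_
    rw [eLpNorm'_neg, ← eN_eq_eLpNorm', ← eN_eq_eLpNorm', ← one_add_one_eq_two]
    exact add_le_add (hf _) (hf _)
  have hsubm : Measurable (f (φ m) - f (φ n)) := (hfm _).sub (hfm _)
  have hcorner : ∀ I : Set ℝ, I ⊆ Ioi 0 → I.OrdConnected → (∀ t ∈ I, A t ≤ B) →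
      (∫⁻ x in Ioi 0, stieltjesOn lam v w I (fun y => ‖(f (φ m) - f (φ n)) y‖ₑ) x ^ q) ^ (1 / q) ≤
        ENNReal.ofReal (ε / 8) := fun I hI hIc hIB => by
    refine (lintegral_stieltjesOn_le hpp hpq hv hw hI hIc (B := B) ?_ hsubm).trans ?_
    · simpa only [hA] using hIB
    · calc 8 * B * eN p (f (φ m) - f (φ n)) ≤ 8 * B * 2 := by gcongr
        _ = ENNReal.ofReal (8 * (ε / 128) * 2) := by
          rw [ENNReal.ofReal_mul (by positivity), ENNReal.ofReal_mul (by positivity), hBdef]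
          simp
        _ = ENNReal.ofReal (ε / 8) := by congr 1; ring
  have hm₁ := measurable_stieltjesOn (lam := lam) hv hw measurableSet_Ioc (I := Ioc 0 a)
    hsubm.enorm
  have hm₂ := measurable_stieltjesOn (lam := lam) hv hw measurableSet_Ici (I := Ici b) hsubm.enorm
  have hmR : Measurable fun x =>
      ‖offOp lam a b v w (f (φ m)) x - offOp lam a b v w (f (φ n)) x‖ₑ :=
    ((measurable_offOp hv hw (hfm _)).sub (measurable_offOp hv hw (hfm _))).enorm
  have hae := fun k => ae_integrable_or_eq_zero (lam := lam) hpp hpq hv hw hvpos hwpos hsup.ne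
    (fun t ht => by simpa only [hA] using hAtop t ht) (hfm k) (hf k)
  rw [eN_eq_lintegral_enorm]
  calc _ ≤ (∫⁻ x in Ioi (0 : ℝ),
        (‖offOp lam a b v w (f (φ m)) x - offOp lam a b v w (f (φ n)) x‖ₑ +
        (stieltjesOn lam v w (Ioc 0 a) (fun y => ‖(f (φ m) - f (φ n)) y‖ₑ) x +
          stieltjesOn lam v w (Ici b) (fun y => ‖(f (φ m) - f (φ n)) y‖ₑ) x)) ^ q) ^ (1 / q) := by
        gcongr ?_ ^ _
        refine lintegral_mono_ae ?_
        filter_upwards [hae (φ m), hae (φ n), ae_restrict_mem measurableSet_Ioi] with x h1 h2 hx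
        exact ENNReal.rpow_le_rpow
          (enorm_SOp_sub_le hvpos hv hwpos ha hab (hfm _) (hfm _) hx h1 h2) hq0.le
    _ ≤ _ := ENNReal.lintegral_Lp_add_le hmR.aemeasurable (hm₁.add hm₂).aemeasurable hq1
    _ ≤ ENNReal.ofReal (ε / 4) + (ENNReal.ofReal (ε / 8) + ENNReal.ofReal (ε / 8)) := by
        refine add_le_add hmn ((ENNReal.lintegral_Lp_add_le hm₁.aemeasurable hm₂.aemeasurable
          hq1).trans (add_le_add ?_ ?_))
        · exact hcorner _ Ioc_subset_Ioi_self ordConnected_Ioc haB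
        · exact hcorner _ (fun y hy => hb.trans_le hy) ordConnected_Ici hbB
    _ = ENNReal.ofReal (ε / 2) := by
        rw [← ENNReal.ofReal_add (by positivity) (by positivity),
          ← ENNReal.ofReal_add (by positivity) (by positivity)]
        congr 1
        ring
    _ < ENNReal.ofReal ε := (ENNReal.ofReal_lt_ofReal_iff hε).2 (by linarith)

end Sufficiency

section CompactImage

variable {lam p q : ℝ} {v w : ℝ → ℝ}

lemma measurable_SOp (hv : Measurable v) (hw : Measurable w) {f : ℝ → ℝ} (hf : Measurable f) :
    Measurable (SOp lam v w f) := by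
  refine hw.mul (StronglyMeasurable.integral_prod_right
    (f := fun x y => f y * v y / (x ^ lam + y ^ lam)) ?_).measurable
  refine Measurable.stronglyMeasurable ?_
  have h1 : Measurable fun z : ℝ × ℝ => f z.2 := hf.comp measurable_snd
  have h2 : Measurable fun z : ℝ × ℝ => v z.2 := hv.comp measurable_snd
  exact (h1.mul h2).div (by fun_prop)

lemma SOp_const_smul (c : ℝ) (f : ℝ → ℝ) : SOp lam v w (c • f) = c • SOp lam v w f := by
  ext x
  simp only [SOp, Pi.smul_apply, smul_eq_mul, mul_assoc, mul_div_assoc]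
  rw [integral_const_mul]
  ring

/-- A compact Stieltjes operator maps the unit ball of `L^p` into `L^q`. -/
lemma SCompact.eN_SOp_ne_top (h : SCompact lam p q v w) (hp0 : 0 < p) (hq0 : 0 < q) {f : ℝ → ℝ}
    (hfm : Measurable f) (hf : eN p f ≤ 1) : eN q (SOp lam v w f) ≠ ⊤ := by
  intro htop
  set c : ℕ → ℝ := fun n => 1 / ((n : ℝ) + 1)
  obtain ⟨φ, hφ, hC⟩ := h (fun n => c n • f) (fun n => hfm.const_smul (c n)) fun n => by
    rw [eN_eq_eLpNorm', eLpNorm'_const_smul _ hp0, ← eN_eq_eLpNorm']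
    refine mul_le_one' ?_ hf
    rw [Real.enorm_eq_ofReal (by positivity), ENNReal.ofReal_le_one]
    exact div_le_one_of_le₀ (by linarith [n.cast_nonneg (α := ℝ)]) (by positivity)
  obtain ⟨N, hN⟩ := hC 1 one_pos
  have hlt := hN N le_rfl (N + 1) N.le_succ
  simp only [SOp_const_smul] at hlt
  have heq : (fun x => (c (φ N) • SOp lam v w f) x - (c (φ (N + 1)) • SOp lam v w f) x) =
      (c (φ N) - c (φ (N + 1))) • SOp lam v w f := by
    ext x
    simp only [Pi.smul_apply, smul_eq_mul]
    ring
  rw [heq, eN_eq_eLpNorm', eLpNorm'_const_smul _ hq0, ← eN_eq_eLpNorm', htop,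
    ENNReal.mul_top] at hlt
  · exact not_top_lt hlt
  · rw [Ne, enorm_eq_zero, sub_eq_zero]
    intro hc
    have h1 : (φ N : ℝ) + 1 = φ (N + 1) + 1 := by simpa [c] using hc
    exact (hφ N.lt_succ_self).ne (by exact_mod_cast add_right_cancel h1)

lemma eLpNorm'_restrict_le_eN (hq0 : 0 < q) {G : Set ℝ} (hG : G ⊆ Ioi 0) (g : ℝ → ℝ) :
    eLpNorm' g q (volume.restrict G) ≤ eN q g := by
  rw [eN_eq_eLpNorm']
  exact eLpNorm'_mono_measure _ (Measure.restrict_mono_set _ hG) hq0.le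

lemma eLpNorm'_le_eN_sub_add (hq1 : 1 ≤ q) {F : Set ℝ} (hF : F ⊆ Ioi 0) {g h : ℝ → ℝ}
    (hg : Measurable g) (hh : Measurable h) :
    eLpNorm' g q (volume.restrict F) ≤
      eN q (fun x => g x - h x) + eLpNorm' h q (volume.restrict F) := by
  have hq0 : 0 < q := one_pos.trans_le hq1
  calc eLpNorm' g q (volume.restrict F) = eLpNorm' ((g - h) + h) q (volume.restrict F) := by
        rw [sub_add_cancel]
    _ ≤ eLpNorm' (g - h) q (volume.restrict F) + eLpNorm' h q (volume.restrict F) :=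
        eLpNorm'_add_le (hg.sub hh).aestronglyMeasurable hh.aestronglyMeasurable hq1
    _ ≤ _ := by
        gcongr
        exact eLpNorm'_restrict_le_eN hq0 hF _

/-- A compact Stieltjes operator is bounded. -/
lemma SCompact.exists_eN_SOp_le (h : SCompact lam p q v w) (hp0 : 0 < p) (hq1 : 1 ≤ q)
    (hv : Measurable v) (hw : Measurable w) :
    ∃ C : ℝ≥0∞, C ≠ ⊤ ∧ ∀ f, Measurable f → eN p f ≤ 1 → eN q (SOp lam v w f) ≤ C := by
  by_contra! hcon
  choose f hfm hf hlarge using fun n : ℕ => hcon n (ENNReal.natCast_ne_top n)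
  obtain ⟨φ, hφ, hC⟩ := h f hfm hf
  obtain ⟨N, hN⟩ := hC 1 one_pos
  have hfin := h.eN_SOp_ne_top hp0 (one_pos.trans_le hq1) (hfm (φ N)) (hf (φ N))
  obtain ⟨k, hk⟩ := ENNReal.exists_nat_gt
    (ENNReal.add_ne_top.2 ⟨ENNReal.ofReal_ne_top (r := 1), hfin⟩)
  have hle := eLpNorm'_le_eN_sub_add hq1 subset_rfl
    (measurable_SOp (lam := lam) hv hw (hfm (φ (max N k))))
    (measurable_SOp (lam := lam) hv hw (hfm (φ N)))
  rw [← eN_eq_eLpNorm', ← eN_eq_eLpNorm'] at hle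
  have hlt := (hlarge (φ (max N k))).trans_le
    (hle.trans (add_le_add_left (hN _ (le_max_left N k) N le_rfl).le _))
  have hkφ : (k : ℝ≥0∞) ≤ φ (max N k) :=
    Nat.cast_le.2 ((le_max_right N k).trans (hφ.id_le _))
  exact (hkφ.trans_lt hlt).not_gt hk

lemma tendsto_setLIntegral_zero_of_eventually_notMem {ι : Type*} {l : Filter ι}
    [l.IsCountablyGenerated] {F : ι → Set ℝ} {G : Set ℝ} (hFm : ∀ i, MeasurableSet (F i))
    (hFG : ∀ᶠ i in l, F i ⊆ G) (hF : ∀ x, ∀ᶠ i in l, x ∉ F i) {g : ℝ → ℝ≥0∞} (hg : Measurable g)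
    (hfin : ∫⁻ x in G, g x ≠ ⊤) : Tendsto (fun i => ∫⁻ x in F i, g x) l (𝓝 0) := by
  have h := tendsto_lintegral_filter_of_dominated_convergence (μ := volume.restrict G) (l := l)
    (F := fun i => (F i).indicator g) (f := fun _ => 0) g
    (.of_forall fun i => hg.indicator (hFm i))
    (.of_forall fun i => .of_forall fun x => indicator_le_self _ _ _) hfin
    (.of_forall fun x => tendsto_const_nhds.congr'
      ((hF x).mono fun i hi => (indicator_of_notMem hi g).symm))
  rw [lintegral_zero] at h
  refine h.congr' (hFG.mono fun i hi => ?_)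
  rw [lintegral_indicator (hFm i), Measure.restrict_restrict (hFm i), inter_eq_left.2 hi]

/-- The image of the unit ball under a compact Stieltjes operator has uniformly small mass on
vanishing sets. -/
lemma SCompact.not_forall_le_eLpNorm' (h : SCompact lam p q v w) (hp0 : 0 < p) (hq1 : 1 ≤ q)
    (hv : Measurable v) (hw : Measurable w) {f : ℕ → ℝ → ℝ} (hfm : ∀ n, Measurable (f n))
    (hf : ∀ n, eN p (f n) ≤ 1) {F : ℕ → Set ℝ} (hFm : ∀ n, MeasurableSet (F n))
    (hF0 : ∀ n, F n ⊆ Ioi 0) (hF : ∀ x, ∀ᶠ n in atTop, x ∉ F n) {ε : ℝ} (hε : 0 < ε) :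
    ¬ ∀ n, ENNReal.ofReal ε ≤ eLpNorm' (SOp lam v w (f n)) q (volume.restrict (F n)) := by
  intro hle
  have hq0 : 0 < q := one_pos.trans_le hq1
  obtain ⟨φ, hφ, hC⟩ := h f hfm hf
  obtain ⟨N, hN⟩ := hC (ε / 2) (half_pos hε)
  have hfin := h.eN_SOp_ne_top hp0 hq0 (hfm (φ N)) (hf (φ N))
  have hmS := fun n => measurable_SOp (lam := lam) hv hw (hfm n)
  rw [eN_eq_lintegral_enorm, Ne, ENNReal.rpow_eq_top_iff_of_pos (by positivity)] at hfin
  have hlim := tendsto_setLIntegral_zero_of_eventually_notMem (fun n => hFm (φ n))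
    (.of_forall fun n => hF0 (φ n)) (fun x => hφ.tendsto_atTop.eventually (hF x))
    ((hmS (φ N)).enorm.pow_const q) hfin
  have hlim' := ((ENNReal.continuous_rpow_const (y := 1 / q)).tendsto _).comp hlim
  rw [ENNReal.zero_rpow_of_pos (by positivity)] at hlim'
  obtain ⟨m, hm, hNm⟩ := ((hlim'.eventually_le_const
    (show 0 < ENNReal.ofReal (ε / 2) by simpa using hε)).and (eventually_ge_atTop N)).exists
  refine (lt_irrefl (ENNReal.ofReal ε)) ?_
  calc ENNReal.ofReal ε ≤ _ := hle (φ m)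
    _ ≤ _ := eLpNorm'_le_eN_sub_add hq1 (hF0 _) (hmS (φ m)) (hmS (φ N))
    _ < ENNReal.ofReal (ε / 2) + ENNReal.ofReal (ε / 2) :=
        ENNReal.add_lt_add_of_lt_of_le (ne_top_of_le_ne_top ENNReal.ofReal_ne_top hm)
          (hN m hNm N le_rfl) hm
    _ = ENNReal.ofReal ε := by
        rw [← ENNReal.ofReal_add (by positivity) (by positivity), add_halves]

/-- If the images of a sequence in the unit ball under a compact Stieltjes operator converge
to zero almost everywhere, then they are not bounded away from zero in norm. -/
lemma SCompact.not_forall_le_eN (h : SCompact lam p q v w) (hq0 : 0 < q)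
    (hv : Measurable v) (hw : Measurable w) {f : ℕ → ℝ → ℝ} (hfm : ∀ n, Measurable (f n))
    (hf : ∀ n, eN p (f n) ≤ 1)
    (hlim : ∀ x > 0, Tendsto (fun n => SOp lam v w (f n) x) atTop (𝓝 0)) {ε : ℝ} (hε : 0 < ε) :
    ¬ ∀ n, ENNReal.ofReal ε ≤ eN q (SOp lam v w (f n)) := by
  intro hle
  obtain ⟨φ, hφ, hC⟩ := h f hfm hf
  obtain ⟨N, hN⟩ := hC (ε / 2) (half_pos hε)
  have hmS := fun n => measurable_SOp (lam := lam) hv hw (hfm n)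
  have hbound : eN q (SOp lam v w (f (φ N))) ≤ ENNReal.ofReal (ε / 2) := by
    rw [eN_eq_lintegral_enorm, one_div, ENNReal.rpow_inv_le_iff hq0]
    calc ∫⁻ x in Ioi 0, ‖SOp lam v w (f (φ N)) x‖ₑ ^ q
        = ∫⁻ x in Ioi 0, liminf (fun m =>
            ‖SOp lam v w (f (φ N)) x - SOp lam v w (f (φ m)) x‖ₑ ^ q) atTop := by
          refine setLIntegral_congr_fun measurableSet_Ioi fun x hx => ?_
          have h1 := ((hlim x hx).comp hφ.tendsto_atTop).const_sub (SOp lam v w (f (φ N)) x)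
          rw [sub_zero] at h1
          exact (((ENNReal.continuous_rpow_const (y := q)).tendsto _).comp h1.enorm).liminf_eq.symm
      _ ≤ _ := lintegral_liminf_le fun m => ((hmS _).sub (hmS _)).enorm.pow_const q
      _ ≤ ENNReal.ofReal (ε / 2) ^ q := by
          refine liminf_le_of_frequently_le' (Eventually.frequently ?_)
          filter_upwards [eventually_ge_atTop N] with m hm
          have h1 := (hN N le_rfl m hm).le
          rwa [eN_eq_lintegral_enorm, one_div, ENNReal.rpow_inv_le_iff hq0] at h1
  have h2 := (hle (φ N)).trans hbound
  rw [ENNReal.ofReal_le_ofReal_iff (by positivity)] at h2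
  linarith

end CompactImage

section Testing

variable {lam p p' q : ℝ} {v w : ℝ → ℝ} {β : ℝ → ℝ≥0∞} {E F : Set ℝ}

lemma le_two_mul_stieltjesKernel (hlam : 0 < lam) {x y : ℝ} (hy : 0 < y) (hyx : y ≤ x) :
    ENNReal.ofReal x ^ (-lam) ≤ 2 * stieltjesKernel lam x y := by
  have hx : 0 < x := hy.trans_le hyx
  have hxl := Real.rpow_pos_of_pos hx lam
  have hyl := Real.rpow_pos_of_pos hy lam
  have hle : y ^ lam ≤ x ^ lam := Real.rpow_le_rpow hy.le hyx hlam.le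
  rw [stieltjesKernel, ENNReal.ofReal_rpow_of_pos hx, Real.rpow_neg hx.le,
    ← ENNReal.ofReal_ofNat 2, ← ENNReal.ofReal_mul (by positivity)]
  refine ENNReal.ofReal_le_ofReal ?_
  rw [inv_eq_one_div, mul_one_div, div_le_div_iff₀ hxl (by positivity)]
  linarith

lemma enorm_SOp_le (hvpos : ∀ y, 0 ≤ v y) (hwpos : ∀ x, 0 ≤ w x) (f : ℝ → ℝ) {x : ℝ}
    (hx : 0 < x) : ‖SOp lam v w f x‖ₑ ≤ ENNReal.ofReal (w x) *
      ∫⁻ y in Ioi 0, ‖f y‖ₑ * (ENNReal.ofReal (v y) * stieltjesKernel lam x y) := by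
  rw [SOp, enorm_mul, Real.enorm_eq_ofReal (hwpos x)]
  gcongr
  refine (enorm_integral_le_lintegral_enorm _).trans_eq ?_
  exact setLIntegral_congr_fun measurableSet_Ioi fun y hy => enorm_stieltjes_integrand hvpos hx hy

lemma enorm_SOp_eq (hv : Measurable v) (hvpos : ∀ y, 0 ≤ v y) (hwpos : ∀ x, 0 ≤ w x) {f : ℝ → ℝ}
    (hf : Measurable f) (hfpos : ∀ y, 0 ≤ f y) {x : ℝ} (hx : 0 < x)
    (hfin : ∫⁻ y in Ioi 0, ‖f y‖ₑ * (ENNReal.ofReal (v y) * stieltjesKernel lam x y) ≠ ⊤) :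
    ‖SOp lam v w f x‖ₑ = ENNReal.ofReal (w x) *
      ∫⁻ y in Ioi 0, ‖f y‖ₑ * (ENNReal.ofReal (v y) * stieltjesKernel lam x y) := by
  have heq : ∫⁻ y in Ioi 0, ‖f y * v y / (x ^ lam + y ^ lam)‖ₑ =
      ∫⁻ y in Ioi 0, ‖f y‖ₑ * (ENNReal.ofReal (v y) * stieltjesKernel lam x y) :=
    setLIntegral_congr_fun measurableSet_Ioi fun y hy => enorm_stieltjes_integrand hvpos hx hy
  have hnn : ∀ y ∈ Ioi (0 : ℝ), 0 ≤ f y * v y / (x ^ lam + y ^ lam) := fun y hy => by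
    have := Real.rpow_pos_of_pos hx lam
    have := Real.rpow_pos_of_pos (mem_Ioi.1 hy) lam
    exact div_nonneg (mul_nonneg (hfpos y) (hvpos y)) (by positivity)
  have hint : IntegrableOn (fun y => f y * v y / (x ^ lam + y ^ lam)) (Ioi 0) :=
    ⟨(show Measurable fun y => f y * v y / (x ^ lam + y ^ lam) by fun_prop).aestronglyMeasurable,
      (heq.trans_ne hfin).lt_top⟩
  rw [SOp, enorm_mul, Real.enorm_eq_ofReal (hwpos x), ← heq,
    ← ofReal_integral_norm_eq_lintegral_enorm hint,
    Real.enorm_eq_ofReal (setIntegral_nonneg measurableSet_Ioi hnn)]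
  congr 2
  exact setIntegral_congr_fun measurableSet_Ioi fun y hy => (Real.norm_of_nonneg (hnn y hy)).symm

/-- The extremal function in Hölder's inequality against the weight `vβ` on `E`. -/
lemma exists_extremal (hpp : p.HolderConjugate p') (hv : Measurable v)
    (hvpos : ∀ y, 0 ≤ v y) (hwpos : ∀ x, 0 ≤ w x) (hβ : Measurable β) (hE : MeasurableSet E)
    (hE0 : E ⊆ Ioi 0) (hβtop : ∀ y ∈ E, β y ≠ ⊤)
    (hM : ∫⁻ y in E, (ENNReal.ofReal (v y) * β y) ^ p' ≠ ⊤) :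
    ∃ f : ℝ → ℝ, Measurable f ∧ eN p f ≤ 1 ∧ (∀ y ∉ E, f y = 0) ∧
      ∀ x > 0, ∀ α : ℝ≥0∞, α ≠ ⊤ → (∀ y ∈ E, stieltjesKernel lam x y ≤ α * β y) →
        (∀ y ∈ E, α * β y ≤ 2 * stieltjesKernel lam x y) →
        (∫⁻ y in E, (ENNReal.ofReal (v y) * β y) ^ p') ^ (1 / p') * (ENNReal.ofReal (w x) * α) ≤
          2 * ‖SOp lam v w f x‖ₑ := by
  have hp0 := hpp.pos
  have hp'0 := hpp.symm.pos
  have hp'1 := hpp.symm.lt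
  have hexp : (p' - 1) * p = p' := by
    have := hpp.symm.sub_one_mul_conj
    linarith
  have hsum : 1 - 1 / p = 1 / p' := by
    have := hpp.inv_add_inv_eq_one
    rw [one_div, one_div]
    linarith
  set M := ∫⁻ y in E, (ENNReal.ofReal (v y) * β y) ^ p' with hMdef
  rcases eq_or_ne M 0 with hM0 | hM0
  · refine ⟨0, measurable_zero, ?_, fun _ _ => rfl, fun x _ α _ _ _ => ?_⟩
    · simp [eN, hp0]
    · rw [hM0, ENNReal.zero_rpow_of_pos (by positivity), zero_mul]
      exact zero_le
  set u : ℝ → ℝ≥0∞ := fun y => ENNReal.ofReal (v y) * β y with hu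
  have hum : Measurable u := hv.ennreal_ofReal.mul hβ
  set h : ℝ → ℝ≥0∞ := E.indicator fun y => M ^ (-(1 / p)) * u y ^ (p' - 1) with hh
  have hhm : Measurable h := ((hum.pow_const _).const_mul _).indicator hE
  have hMp : M ^ (-(1 / p)) ≠ ⊤ := by simp [hM0, hM, ENNReal.rpow_eq_top_iff]
  have hhtop : ∀ y, h y ≠ ⊤ := fun y => by
    by_cases hy : y ∈ E
    · rw [hh, indicator_of_mem hy]
      exact ENNReal.mul_ne_top hMp (ENNReal.rpow_ne_top_of_nonneg (by linarith)
        (ENNReal.mul_ne_top ENNReal.ofReal_ne_top (hβtop y hy)))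
    · simp [hh, hy]
  have henorm : ∀ y, ‖(h y).toReal‖ₑ = h y := fun y => by
    rw [Real.enorm_eq_ofReal ENNReal.toReal_nonneg, ENNReal.ofReal_toReal (hhtop y)]
  have hMM : M ^ (-(1 / p)) * M = M ^ (1 / p') := by
    nth_rw 2 [← ENNReal.rpow_one M]
    rw [← ENNReal.rpow_add _ _ hM0 hM, ← hsum]
    congr 1
    ring
  have hupow : ∀ y, u y ^ (p' - 1) * u y = u y ^ p' := fun y => by
    nth_rw 2 [← ENNReal.rpow_one (u y)]
    rw [← ENNReal.rpow_add_of_nonneg _ _ (by linarith) zero_le_one, sub_add_cancel]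
  have hkey : ∀ α : ℝ≥0∞, ∫⁻ y in E, M ^ (-(1 / p)) * u y ^ (p' - 1) *
      (ENNReal.ofReal (v y) * (α * β y)) = M ^ (1 / p') * α := fun α => by
    rw [← hMM, mul_right_comm, hMdef, ← lintegral_const_mul _ (hum.pow_const p')]
    refine lintegral_congr fun y => ?_
    rw [← hupow y, hu]
    ring
  refine ⟨fun y => (h y).toReal, hhm.ennreal_toReal, ?_, fun y hy => by simp [hh, hy],
    fun x hx α hα hle hge => ?_⟩
  · rw [eN_eq_lintegral_enorm]
    simp only [henorm]
    rw [hh, lintegral_indicator_rpow hE hp0, inter_eq_left.2 hE0,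
      lintegral_const_mul_rpow_rpow hp0 _ (hum.pow_const _)]
    simp only [← ENNReal.rpow_mul, hexp]
    rw [← hMdef, ← ENNReal.rpow_add _ _ hM0 hM, neg_add_cancel, ENNReal.rpow_zero]
  · have hI : ∫⁻ y in Ioi 0, ‖(h y).toReal‖ₑ * (ENNReal.ofReal (v y) * stieltjesKernel lam x y) =
        ∫⁻ y in E, M ^ (-(1 / p)) * u y ^ (p' - 1) *
          (ENNReal.ofReal (v y) * stieltjesKernel lam x y) := by
      have hres : volume.restrict E = (volume.restrict (Ioi 0)).restrict E := by
        rw [Measure.restrict_restrict hE, inter_eq_left.2 hE0]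
      simp only [henorm]
      rw [hres, ← lintegral_indicator hE]
      refine lintegral_congr fun y => ?_
      by_cases hy : y ∈ E <;> simp [hh, hy]
    have hIle : ∫⁻ y in E, M ^ (-(1 / p)) * u y ^ (p' - 1) *
        (ENNReal.ofReal (v y) * stieltjesKernel lam x y) ≤ M ^ (1 / p') * α := by
      rw [← hkey α]
      refine setLIntegral_mono' hE fun y hy => ?_
      gcongr
      exact hle y hy
    have hIge : M ^ (1 / p') * α ≤ 2 * ∫⁻ y in E, M ^ (-(1 / p)) * u y ^ (p' - 1) *
        (ENNReal.ofReal (v y) * stieltjesKernel lam x y) := by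
      rw [← hkey α, ← lintegral_const_mul' _ _ ENNReal.ofNat_ne_top]
      refine setLIntegral_mono' hE fun y hy => ?_
      rw [mul_left_comm 2, mul_left_comm 2]
      gcongr _ * (_ * ?_)
      exact hge y hy
    rw [enorm_SOp_eq hv hvpos hwpos hhm.ennreal_toReal (fun y => ENNReal.toReal_nonneg) hx, hI]
    · calc _ = ENNReal.ofReal (w x) * (M ^ (1 / p') * α) := by ring
        _ ≤ ENNReal.ofReal (w x) * (2 * ∫⁻ y in E, M ^ (-(1 / p)) * u y ^ (p' - 1) *
            (ENNReal.ofReal (v y) * stieltjesKernel lam x y)) := by gcongr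
        _ = _ := mul_left_comm _ _ _
    · rw [hI]
      exact ne_top_of_le_ne_top (ENNReal.mul_ne_top
        (ENNReal.rpow_ne_top_of_nonneg (by positivity) hM) hα) hIle

/-- Hölder's inequality for the Stieltjes operator on functions supported in `E`. -/
lemma enorm_SOp_le_of_support (hpp : p.HolderConjugate p') (hv : Measurable v)
    (hvpos : ∀ y, 0 ≤ v y) (hwpos : ∀ x, 0 ≤ w x) (hβ : Measurable β) (hE : MeasurableSet E)
    (hE0 : E ⊆ Ioi 0) {f : ℝ → ℝ} (hfm : Measurable f) (hf : eN p f ≤ 1)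
    (hfE : ∀ y ∉ E, f y = 0) {x : ℝ} (hx : 0 < x) {α : ℝ≥0∞}
    (hK : ∀ y > 0, stieltjesKernel lam x y ≤ α * β y) :
    ‖SOp lam v w f x‖ₑ ≤ ENNReal.ofReal (w x) * (α *
      (∫⁻ y in E, (ENNReal.ofReal (v y) * β y) ^ p') ^ (1 / p')) := by
  refine (enorm_SOp_le hvpos hwpos f hx).trans ?_
  gcongr
  have hum : Measurable fun y => ENNReal.ofReal (v y) * β y := hv.ennreal_ofReal.mul hβ
  calc ∫⁻ y in Ioi 0, ‖f y‖ₑ * (ENNReal.ofReal (v y) * stieltjesKernel lam x y)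
      ≤ ∫⁻ y in Ioi 0, α * (‖f y‖ₑ * E.indicator (fun y => ENNReal.ofReal (v y) * β y) y) := by
        refine setLIntegral_mono' measurableSet_Ioi fun y hy => ?_
        by_cases hyE : y ∈ E
        · rw [indicator_of_mem hyE, mul_left_comm α, mul_left_comm α]
          gcongr
          exact hK y hy
        · simp [hfE y hyE]
    _ = α * ∫⁻ y in Ioi 0, ‖f y‖ₑ * E.indicator (fun y => ENNReal.ofReal (v y) * β y) y :=
        lintegral_const_mul _ (hfm.enorm.mul (hum.indicator hE))
    _ ≤ α * (eN p f * (∫⁻ y in E, (ENNReal.ofReal (v y) * β y) ^ p') ^ (1 / p')) := by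
        gcongr
        have hH := ENNReal.lintegral_mul_le_Lp_mul_Lq (volume.restrict (Ioi 0)) hpp
          hfm.enorm.aemeasurable (hum.indicator hE).aemeasurable
        rwa [lintegral_indicator_rpow hE hpp.symm.pos, inter_eq_left.2 hE0,
          ← eN_eq_lintegral_enorm] at hH
    _ ≤ _ := by
        gcongr
        exact mul_le_of_le_one_left zero_le hf

/-- The Hardy characteristic of the weights `vβ` on `E` and `wα` on `F`. -/
def hardyChar (p' q : ℝ) (v w : ℝ → ℝ) (α β : ℝ → ℝ≥0∞) (E F : Set ℝ) : ℝ≥0∞ :=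
  (∫⁻ y in E, (ENNReal.ofReal (v y) * β y) ^ p') ^ (1 / p') *
    (∫⁻ x in F, (ENNReal.ofReal (w x) * α x) ^ q) ^ (1 / q)

variable {α : ℝ → ℝ≥0∞}

lemma exists_lt_two_mul_eLpNorm'_SOp (hpp : p.HolderConjugate p') (hq0 : 0 < q)
    (hv : Measurable v) (hw : Measurable w) (hvpos : ∀ y, 0 ≤ v y) (hwpos : ∀ x, 0 ≤ w x)
    (hα : Measurable α) (hβ : Measurable β)
    (hαtop : ∀ x > 0, α x ≠ ⊤) (hβtop : ∀ y > 0, β y ≠ ⊤)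
    (hK : ∀ x > 0, ∀ y > 0, stieltjesKernel lam x y ≤ α x * β y)
    (hloc : ∀ a > 0, ∀ b, ∫⁻ y in Icc a b, (ENNReal.ofReal (v y) * β y) ^ p' ≠ ⊤)
    (hE : MeasurableSet E) (hE0 : E ⊆ Ioi 0) (hF : MeasurableSet F) (hF0 : F ⊆ Ioi 0)
    (hEF : ∀ x ∈ F, ∀ y ∈ E, α x * β y ≤ 2 * stieltjesKernel lam x y) {ε : ℝ≥0∞}
    (hε : ε < hardyChar p' q v w α β E F) :
    ∃ f : ℝ → ℝ, Measurable f ∧ eN p f ≤ 1 ∧ (∀ y ∉ E, f y = 0) ∧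
      ε < 2 * eLpNorm' (SOp lam v w f) q (volume.restrict F) := by
  have hp'0 := hpp.symm.pos
  set G : ℕ → Set ℝ := fun n => E ∩ Icc (1 / ((n : ℝ) + 1)) n with hG
  have hGmono : Monotone G := fun m n hmn => by
    have hmn' : (m : ℝ) ≤ n := Nat.cast_le.2 hmn
    exact inter_subset_inter_right _ (Icc_subset_Icc (by gcongr) hmn')
  have hGU : ⋃ n, G n = E := by
    refine Subset.antisymm (iUnion_subset fun n => inter_subset_left) fun y hy => ?_
    obtain ⟨m, hm⟩ := exists_nat_one_div_lt (show (0 : ℝ) < y from hE0 hy)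
    obtain ⟨k, hk⟩ := exists_nat_ge y
    refine mem_iUnion.2 ⟨max m k, hy, ?_, hk.trans (Nat.cast_le.2 (le_max_right m k))⟩
    refine le_trans ?_ hm.le
    have : (m : ℝ) ≤ (max m k : ℕ) := Nat.cast_le.2 (le_max_left m k)
    gcongr
  have hlim : Tendsto (fun n => hardyChar p' q v w α β (G n) F) atTop
      (𝓝 (hardyChar p' q v w α β E F)) := by
    refine ENNReal.Tendsto.mul_const ?_ (.inl (left_ne_zero_of_mul hε.ne_bot))
    refine ((ENNReal.continuous_rpow_const (y := 1 / p')).tendsto _).comp ?_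
    have hsup := setLIntegral_iUnion_of_directed (μ := volume)
      (fun y => (ENNReal.ofReal (v y) * β y) ^ p') hGmono.directed_le
    rw [hGU] at hsup
    rw [hsup]
    exact tendsto_atTop_iSup fun m n hmn => lintegral_mono_set (hGmono hmn)
  obtain ⟨n, hn⟩ := (hlim.eventually_const_lt hε).exists
  obtain ⟨f, hfm, hf, hfG, hfx⟩ := exists_extremal (lam := lam) hpp hv hvpos hwpos hβ
    (hE.inter measurableSet_Icc) (inter_subset_left.trans hE0)
    (fun y hy => hβtop y (hE0 hy.1)) (ne_top_of_le_ne_top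
      (hloc (1 / ((n : ℝ) + 1)) (by positivity) n) (lintegral_mono_set inter_subset_right))
  refine ⟨f, hfm, hf, fun y hy => hfG y fun h => hy h.1, hn.trans_le ?_⟩
  rw [hardyChar, eLpNorm'_eq_lintegral_enorm, ← lintegral_const_mul_rpow_rpow hq0 _
    (show Measurable fun x => ENNReal.ofReal (w x) * α x from hw.ennreal_ofReal.mul hα),
    ← lintegral_const_mul_rpow_rpow hq0 _
    (measurable_SOp hv hw hfm).enorm]
  gcongr ?_ ^ _
  refine setLIntegral_mono' hF fun x hx => ?_
  refine ENNReal.rpow_le_rpow ?_ hq0.le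
  exact hfx x (hF0 hx) (α x) (hαtop x (hF0 hx)) (fun y hy => hK x (hF0 hx) y (hE0 hy.1))
    fun y hy => hEF x hx y hy.1

end Testing

section Necessity

variable {lam p p' q : ℝ} {v w : ℝ → ℝ} {α β : ℝ → ℝ≥0∞} {E F : ℝ → Set ℝ}

/-- The Stieltjes kernel is dominated by `α(x) β(y)`, and comparable to it on the sets
`F t × E t`, with `vβ` locally in `L^{p'}`. -/
structure KernelComparison (lam p' : ℝ) (v : ℝ → ℝ) (α β : ℝ → ℝ≥0∞) (E F : ℝ → Set ℝ) :
    Prop where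
  measurable_left : Measurable α
  measurable_right : Measurable β
  left_ne_top : ∀ x > 0, α x ≠ ⊤
  right_ne_top : ∀ y > 0, β y ≠ ⊤
  kernel_le : ∀ x > 0, ∀ y > 0, stieltjesKernel lam x y ≤ α x * β y
  lintegral_ne_top : ∀ a > 0, ∀ b, ∫⁻ y in Icc a b, (ENNReal.ofReal (v y) * β y) ^ p' ≠ ⊤
  measurableSet_source : ∀ t, MeasurableSet (E t)
  measurableSet_target : ∀ t, MeasurableSet (F t)
  source_subset : ∀ t > 0, E t ⊆ Ioi 0
  target_subset : ∀ t > 0, F t ⊆ Ioi 0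
  le_kernel : ∀ t > 0, ∀ x ∈ F t, ∀ y ∈ E t, α x * β y ≤ 2 * stieltjesKernel lam x y

lemma KernelComparison.exists_test (hc : KernelComparison lam p' v α β E F)
    (hpp : p.HolderConjugate p') (hq0 : 0 < q)
    (hv : Measurable v) (hw : Measurable w) (hvpos : ∀ y, 0 ≤ v y) (hwpos : ∀ x, 0 ≤ w x)
    {t : ℝ} (ht : 0 < t) {ε : ℝ≥0∞} (hε : ε < hardyChar p' q v w α β (E t) (F t)) :
    ∃ f : ℝ → ℝ, Measurable f ∧ eN p f ≤ 1 ∧ (∀ y ∉ E t, f y = 0) ∧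
      ε < 2 * eLpNorm' (SOp lam v w f) q (volume.restrict (F t)) :=
  exists_lt_two_mul_eLpNorm'_SOp hpp hq0 hv hw hvpos hwpos hc.measurable_left hc.measurable_right
    hc.left_ne_top hc.right_ne_top hc.kernel_le hc.lintegral_ne_top (hc.measurableSet_source t)
    (hc.source_subset t ht) (hc.measurableSet_target t) (hc.target_subset t ht)
    (hc.le_kernel t ht) hε

lemma SCompact.exists_hardyChar_le (h : SCompact lam p q v w)
    (hc : KernelComparison lam p' v α β E F) (hpp : p.HolderConjugate p') (hq1 : 1 ≤ q)
    (hv : Measurable v) (hw : Measurable w) (hvpos : ∀ y, 0 ≤ v y) (hwpos : ∀ x, 0 ≤ w x) :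
    ∃ C : ℝ≥0∞, C ≠ ⊤ ∧ ∀ t > 0, hardyChar p' q v w α β (E t) (F t) ≤ C := by
  have hq0 : 0 < q := one_pos.trans_le hq1
  obtain ⟨C, hCtop, hC⟩ := h.exists_eN_SOp_le hpp.pos hq1 hv hw
  refine ⟨2 * C, ENNReal.mul_ne_top ENNReal.ofNat_ne_top hCtop, fun t ht =>
    le_of_forall_lt fun ε hε => ?_⟩
  obtain ⟨f, hfm, hf, -, hlt⟩ := hc.exists_test hpp hq0 hv hw hvpos hwpos ht hε
  refine hlt.trans_le ?_
  gcongr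
  exact (eLpNorm'_restrict_le_eN hq0 (hc.target_subset t ht) _).trans (hC f hfm hf)

/-- Failure of convergence of the Hardy characteristics to zero yields a sequence of test
functions whose images are bounded away from zero. -/
lemma KernelComparison.exists_seq_of_not_tendsto (hc : KernelComparison lam p' v α β E F)
    (hpp : p.HolderConjugate p') (hq0 : 0 < q)
    (hv : Measurable v) (hw : Measurable w) (hvpos : ∀ y, 0 ≤ v y) (hwpos : ∀ x, 0 ≤ w x)
    {l : Filter ℝ} [l.IsCountablyGenerated] (hl : ∀ᶠ t in l, 0 < t)
    (hnot : ¬ Tendsto (fun t => hardyChar p' q v w α β (E t) (F t)) l (𝓝 0)) :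
    ∃ (t : ℕ → ℝ) (f : ℕ → ℝ → ℝ) (ε : ℝ), 0 < ε ∧ Tendsto t atTop l ∧ (∀ n, 0 < t n) ∧
      (∀ n, hardyChar p' q v w α β (E (t n)) (F (t n)) ≠ 0) ∧
      (∀ n, Measurable (f n)) ∧ (∀ n, eN p (f n) ≤ 1) ∧ (∀ n, ∀ y ∉ E (t n), f n y = 0) ∧
      ∀ n, ENNReal.ofReal ε ≤ eLpNorm' (SOp lam v w (f n)) q (volume.restrict (F (t n))) := by
  rw [ENNReal.tendsto_nhds_zero] at hnot
  push Not at hnot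
  obtain ⟨ε, hε, hfreq⟩ := hnot
  obtain ⟨t, htl, ht⟩ := exists_seq_forall_of_frequently (hfreq.and_eventually hl)
  choose f hfm hf hfE hlt using fun n =>
    hc.exists_test hpp hq0 hv hw hvpos hwpos (ht n).2 (ht n).1
  have hεtop : ε / 2 ≠ ⊤ := ENNReal.div_ne_top (ht 0).1.ne_top two_ne_zero
  refine ⟨t, f, (ε / 2).toReal, ENNReal.toReal_pos (ENNReal.half_pos hε.ne').ne' hεtop, htl,
    fun n => (ht n).2, fun n => (bot_le.trans_lt (ht n).1).ne', hfm, hf, hfE, fun n => ?_⟩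
  rw [ENNReal.ofReal_toReal hεtop]
  exact ENNReal.div_le_of_le_mul' (hlt n).le

lemma SCompact.tendsto_hardyChar_of_target (h : SCompact lam p q v w)
    (hc : KernelComparison lam p' v α β E F) (hpp : p.HolderConjugate p') (hq1 : 1 ≤ q)
    (hv : Measurable v) (hw : Measurable w) (hvpos : ∀ y, 0 ≤ v y) (hwpos : ∀ x, 0 ≤ w x)
    {l : Filter ℝ} [l.IsCountablyGenerated] (hl : ∀ᶠ t in l, 0 < t)
    (hF : ∀ x, ∀ᶠ t in l, x ∉ F t) :
    Tendsto (fun t => hardyChar p' q v w α β (E t) (F t)) l (𝓝 0) := by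
  by_contra hnot
  obtain ⟨t, f, ε, hε, htl, ht, -, hfm, hf, -, hle⟩ :=
    hc.exists_seq_of_not_tendsto hpp (one_pos.trans_le hq1) hv hw hvpos hwpos hl hnot
  exact h.not_forall_le_eLpNorm' hpp.pos hq1 hv hw hfm hf
    (fun n => hc.measurableSet_target (t n)) (fun n => hc.target_subset (t n) (ht n))
    (fun x => htl.eventually (hF x)) hε hle

lemma SCompact.tendsto_hardyChar_of_source (h : SCompact lam p q v w)
    (hc : KernelComparison lam p' v α β E F) (hpp : p.HolderConjugate p') (hq1 : 1 ≤ q)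
    (hv : Measurable v) (hw : Measurable w) (hvpos : ∀ y, 0 ≤ v y) (hwpos : ∀ x, 0 ≤ w x)
    {l : Filter ℝ} [l.IsCountablyGenerated] (hl : ∀ᶠ t in l, 0 < t)
    (hE : ∀ y, ∀ᶠ t in l, y ∉ E t) (hEs : ∀ s > 0, ∀ᶠ t in l, E t ⊆ E s) :
    Tendsto (fun t => hardyChar p' q v w α β (E t) (F t)) l (𝓝 0) := by
  by_contra hnot
  have hq0 : 0 < q := one_pos.trans_le hq1
  have hp'0 := hpp.symm.pos
  obtain ⟨C, hCtop, hC⟩ := h.exists_hardyChar_le hc hpp hq1 hv hw hvpos hwpos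
  obtain ⟨t, f, ε, hε, htl, ht, hne, hfm, hf, hfE, hle⟩ :=
    hc.exists_seq_of_not_tendsto hpp hq0 hv hw hvpos hwpos hl hnot
  have hfin : ∫⁻ y in E (t 0), (ENNReal.ofReal (v y) * β y) ^ p' ≠ ⊤ := by
    have h1 := ENNReal.lt_top_of_mul_ne_top_left (ne_top_of_le_ne_top hCtop (hC (t 0) (ht 0)))
      (right_ne_zero_of_mul (hne 0))
    exact ((ENNReal.rpow_lt_top_iff_of_pos (by positivity)).1 h1).ne
  have hM := tendsto_setLIntegral_zero_of_eventually_notMem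
    (fun n => hc.measurableSet_source (t n)) (htl.eventually (hEs (t 0) (ht 0)))
    (fun y => htl.eventually (hE y))
    ((hv.ennreal_ofReal.mul hc.measurable_right).pow_const p') hfin
  have hM' := ((ENNReal.continuous_rpow_const (y := 1 / p')).tendsto _).comp hM
  rw [ENNReal.zero_rpow_of_pos (by positivity)] at hM'
  refine h.not_forall_le_eN hq0 hv hw hfm hf (fun x hx => ?_) hε fun n =>
    (hle n).trans (eLpNorm'_restrict_le_eN hq0 (hc.target_subset _ (ht n)) _)
  have hlim := ENNReal.Tendsto.const_mul (ENNReal.Tendsto.const_mul hM'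
    (.inr (hc.left_ne_top x hx))) (.inr (ENNReal.ofReal_ne_top (r := w x)))
  rw [mul_zero, mul_zero] at hlim
  rw [tendsto_zero_iff_enorm_tendsto_zero]
  exact tendsto_of_tendsto_of_tendsto_of_le_of_le tendsto_const_nhds hlim
    (fun n => zero_le) fun n => enorm_SOp_le_of_support hpp hv hvpos hwpos
      hc.measurable_right (hc.measurableSet_source _) (hc.source_subset _ (ht n)) (hfm n) (hf n)
      (hfE n) hx (hc.kernel_le x hx)

lemma ofReal_rpow_neg_ne_top {x : ℝ} (hx : 0 < x) : ENNReal.ofReal x ^ (-lam) ≠ ⊤ := by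
  rw [ENNReal.ofReal_rpow_of_pos hx]
  exact ENNReal.ofReal_ne_top

lemma kernelComparison_below (hlam : 0 < lam) (hp' : 0 < p') (hvpos : ∀ y, 0 ≤ v y)
    (hlocv : LocallyIntegrableOn (fun y => v y ^ p') (Ioi (0 : ℝ))) :
    KernelComparison lam p' v (fun x => ENNReal.ofReal x ^ (-lam)) (fun _ => 1)
      (fun t => Ioo 0 t) Ioi where
  measurable_left := by fun_prop
  measurable_right := measurable_const
  left_ne_top _ := ofReal_rpow_neg_ne_top
  right_ne_top _ _ := ENNReal.one_ne_top
  kernel_le x hx y hy := by simpa using stieltjesKernel_le_left hx hy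
  lintegral_ne_top a ha b := by simpa using lintegral_Icc_rpow_ne_top hp' hvpos hlocv ha
  measurableSet_source _ := measurableSet_Ioo
  measurableSet_target _ := measurableSet_Ioi
  source_subset _ _ := Ioo_subset_Ioi_self
  target_subset _ ht := Ioi_subset_Ioi (le_of_lt ht)
  le_kernel t _ x hx y hy := by
    simpa using le_two_mul_stieltjesKernel hlam hy.1 (hy.2.trans hx).le

lemma kernelComparison_above (hlam : 0 < lam) (hp' : 0 < p') (hv : Measurable v)
    (hvpos : ∀ y, 0 ≤ v y)
    (hlocv : LocallyIntegrableOn (fun y => v y ^ p') (Ioi (0 : ℝ))) :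
    KernelComparison lam p' v (fun _ => 1) (fun y => ENNReal.ofReal y ^ (-lam))
      Ioi (fun t => Ioo 0 t) where
  measurable_left := measurable_const
  measurable_right := by fun_prop
  left_ne_top _ _ := ENNReal.one_ne_top
  right_ne_top _ := ofReal_rpow_neg_ne_top
  kernel_le x hx y hy := by simpa using stieltjesKernel_le_right hx hy
  lintegral_ne_top a ha b := by
    simpa only [mul_rpow_neg hp'] using
      lintegral_Icc_rpow_neg_mul_ne_top hlam hp' hv hvpos hlocv ha
  measurableSet_source _ := measurableSet_Ioi
  measurableSet_target _ := measurableSet_Ioo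
  source_subset _ ht := Ioi_subset_Ioi (le_of_lt ht)
  target_subset _ _ := Ioo_subset_Ioi_self
  le_kernel t _ x hx y hy := by
    rw [one_mul, stieltjesKernel_comm]
    exact le_two_mul_stieltjesKernel hlam hx.1 (hx.2.trans hy).le

theorem SCompact.iSup_lt_top_and_tendsto (h : SCompact lam p q v w) (hlam : 0 < lam)
    (hpp : p.HolderConjugate p') (hpq : p ≤ q) (hv : Measurable v) (hw : Measurable w)
    (hvpos : ∀ y, 0 ≤ v y) (hwpos : ∀ x, 0 ≤ w x)
    (hlocv : LocallyIntegrableOn (fun y => v y ^ p') (Ioi (0 : ℝ)))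
    {A : ℝ → ℝ≥0∞}
    (hA : A = fun t => V0 p' v t ^ (1 / p') * Winf lam q w t ^ (1 / q) +
      Vinf lam p' v t ^ (1 / p') * W0 q w t ^ (1 / q)) :
    ⨆ t ∈ Ioi (0 : ℝ), A t < ⊤ ∧ Tendsto A (𝓝[>] 0) (𝓝 0) ∧ Tendsto A atTop (𝓝 0) := by
  have hq1 : 1 ≤ q := hpp.lt.le.trans hpq
  have hp'0 := hpp.symm.pos
  have hq0 : 0 < q := one_pos.trans_le hq1
  have hb := kernelComparison_below hlam hp'0 hvpos hlocv
  have ha := kernelComparison_above hlam hp'0 hv hvpos hlocv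
  have hA' : A = fun t =>
      hardyChar p' q v w (fun x => ENNReal.ofReal x ^ (-lam)) (fun _ => 1) (Ioo 0 t) (Ioi t) +
      hardyChar p' q v w (fun _ => 1) (fun y => ENNReal.ofReal y ^ (-lam)) (Ioi t) (Ioo 0 t) := by
    simp only [hA, hardyChar, V0, Winf, Vinf, W0, mul_rpow_neg hq0, mul_rpow_neg hp'0, mul_one]
  have hpos : ∀ᶠ t in 𝓝[>] (0 : ℝ), 0 < t := eventually_mem_nhdsWithin
  have hlt : ∀ x > 0, ∀ᶠ t in 𝓝[>] (0 : ℝ), t < x := fun x hx =>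
    eventually_nhdsWithin_of_eventually_nhds (eventually_lt_nhds hx)
  have hIoo : ∀ x, ∀ᶠ t in 𝓝[>] (0 : ℝ), x ∉ Ioo 0 t := fun x => by
    rcases le_or_gt x 0 with hx | hx
    · exact .of_forall fun t ht => hx.not_gt ht.1
    · exact (hlt x hx).mono fun t ht hxt => ht.not_gt hxt.2
  have hIoi : ∀ x : ℝ, ∀ᶠ t in atTop, x ∉ Ioi t := fun x =>
    (eventually_ge_atTop x).mono fun t ht => not_lt.2 ht
  refine ⟨?_, ?_, ?_⟩
  · obtain ⟨C₁, hC₁top, hC₁⟩ := h.exists_hardyChar_le hb hpp hq1 hv hw hvpos hwpos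
    obtain ⟨C₂, hC₂top, hC₂⟩ := h.exists_hardyChar_le ha hpp hq1 hv hw hvpos hwpos
    refine (iSup₂_le fun t ht => ?_).trans_lt (ENNReal.add_ne_top.2 ⟨hC₁top, hC₂top⟩).lt_top
    rw [hA']
    exact add_le_add (hC₁ t ht) (hC₂ t ht)
  · rw [hA', ← add_zero (0 : ℝ≥0∞)]
    exact (h.tendsto_hardyChar_of_source hb hpp hq1 hv hw hvpos hwpos hpos hIoo
      fun s hs => (hlt s hs).mono fun t ht => Ioo_subset_Ioo_right ht.le).add
      (h.tendsto_hardyChar_of_target ha hpp hq1 hv hw hvpos hwpos hpos hIoo)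
  · rw [hA', ← add_zero (0 : ℝ≥0∞)]
    exact (h.tendsto_hardyChar_of_target hb hpp hq1 hv hw hvpos hwpos (eventually_gt_atTop 0)
      hIoi).add (h.tendsto_hardyChar_of_source ha hpp hq1 hv hw hvpos hwpos
      (eventually_gt_atTop 0) hIoi
      fun s _ => (eventually_ge_atTop s).mono fun t ht => Ioi_subset_Ioi ht)

end Necessity

theorem stmt14 (lam p q : ℝ) (hlam : 0 < lam) (hp : 1 < p) (hpq : p ≤ q)
    (p' : ℝ) (hp' : p' = p / (p - 1))
    (v w : ℝ → ℝ) (hv : Measurable v) (hw : Measurable w)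
    (hvpos : ∀ y, 0 ≤ v y) (hwpos : ∀ x, 0 ≤ w x)
    (hlocv : LocallyIntegrableOn (fun y => v y ^ p') (Ioi (0:ℝ)))
    (hlocw : LocallyIntegrableOn (fun x => w x ^ q) (Ioi (0:ℝ)))
    (A : ℝ → ℝ≥0∞)
    -- `A(t) = A_H(t) + A_{H*}(t)`
    (hA : A = fun t => (V0 p' v t) ^ (1/p') * (Winf lam q w t) ^ (1/q)
      + (Vinf lam p' v t) ^ (1/p') * (W0 q w t) ^ (1/q)) :
    SCompact lam p q v w ↔
      (⨆ t ∈ Ioi (0:ℝ), A t) < ⊤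
        ∧ Tendsto A (nhdsWithin 0 (Ioi 0)) (nhds 0)
        ∧ Tendsto A atTop (nhds 0) := by
  have hpp : p.HolderConjugate p' := by
    rw [hp']
    exact Real.HolderConjugate.conjExponent hp
  exact ⟨fun h => h.iSup_lt_top_and_tendsto hlam hpp hpq hv hw hvpos hwpos hlocv hA,
    fun ⟨hsup, h0, hinf⟩ =>
      SCompact_of_tendsto hlam hpp hpq hv hw hvpos hwpos hlocv hlocw hA hsup h0 hinf⟩
end
end

section
/- Let λ>0, 1≤q<∞, and let v be a non-negative measurable weight on (0,∞). Then the Laplace-type operator 𝓛 is compact from L^∞ to L^q if and only if C_q<∞, where C_q=∫_0^∞ y^{−λ} v(y) dy when q=1, and C_q=(∫_0^∞ t^{−λ} (∫_0^t v)^{q−1} v(t) dt)^{1/q} when 1<q<∞. -/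
open MeasureTheory Set Filter Topology
open scoped ENNReal NNReal

noncomputable section

/-- The Laplace-type operator `𝓛f(x) = ∫_0^∞ e^{-x y^λ} f(y) v(y) dy`. -/
def Lap (lam : ℝ) (v f : ℝ → ℝ) : ℝ → ℝ :=
  fun x => ∫ y in Ioi (0:ℝ), Real.exp (-(x * y ^ lam)) * f y * v y

/-- `‖g‖_∞ = ess sup_{x>0} |g(x)|`. -/
def eNinf (g : ℝ → ℝ) : ℝ≥0∞ :=
  essSup (fun x => ENNReal.ofReal |g x|) (volume.restrict (Ioi (0:ℝ)))

/-- Compactness of the Laplace-type operator from `L^∞` to `L^q` (`q ≥ 1`): the image of the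
closed unit ball of `L^∞` is relatively compact in the complete space `L^q`; equivalently,
every sequence of the unit ball has a subsequence whose image is Cauchy in the `L^q` norm. -/
def LapCompactInftyTo (lam q : ℝ) (v : ℝ → ℝ) : Prop :=
  ∀ f : ℕ → ℝ → ℝ, (∀ n, Measurable (f n)) → (∀ n, eNinf (f n) ≤ 1) →
    ∃ φ : ℕ → ℕ, StrictMono φ ∧
      ∀ ε : ℝ, 0 < ε → ∃ N : ℕ, ∀ m, N ≤ m → ∀ n, N ≤ n →
        eN q (fun x => Lap lam v (f (φ m)) x - Lap lam v (f (φ n)) x) < ENNReal.ofReal ε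

/-- The integral of an exponential tail. -/
lemma lintegral_exp_neg_mul_Ioi {a : ℝ} (ha : 0 < a) (c : ℝ) :
    ∫⁻ x in Ioi c, ENNReal.ofReal (Real.exp (-(a * x))) =
      ENNReal.ofReal (Real.exp (-(a * c)) / a) := by
  have hi := integrableOn_exp_mul_Ioi (a := -a) (by linarith) c
  have h := integral_exp_mul_Ioi (a := -a) (by linarith) c
  simp only [neg_mul] at hi h
  rw [← ofReal_integral_eq_lintegral_ofReal hi (ae_of_all _ fun x => (Real.exp_pos _).le), h]
  congr 1
  field_simp

lemma lintegral_lintegral_exp_neg_mul_rpow {lam c : ℝ} (hc : 0 < c)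
    {w : ℝ → ℝ≥0∞} (hw : Measurable w) :
    ∫⁻ x in Ioi (0:ℝ), ∫⁻ y in Ioi (0:ℝ), ENNReal.ofReal (Real.exp (-(c * (x * y ^ lam)))) * w y =
      ENNReal.ofReal (1 / c) * ∫⁻ y in Ioi (0:ℝ), ENNReal.ofReal y ^ (-lam) * w y := by
  rw [lintegral_lintegral_swap (by fun_prop), ← lintegral_const_mul _ (by fun_prop)]
  refine setLIntegral_congr_fun measurableSet_Ioi fun y hy => ?_
  have hy : 0 < y := hy
  have hp : 0 < y ^ lam := Real.rpow_pos_of_pos hy _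
  rw [lintegral_mul_const _ (by fun_prop), ← mul_assoc]
  congr 1
  have h := lintegral_exp_neg_mul_Ioi (mul_pos hc hp) 0
  rw [ENNReal.ofReal_rpow_of_pos hy, ← ENNReal.ofReal_mul (by positivity)]
  convert h using 2
  · ext x; congr 3; ring
  · rw [Real.rpow_neg hy.le]; simp; ring

lemma lintegral_exp_neg_mul_rpow_eq {lam x : ℝ} (hlam : 0 < lam) (hx : 0 < x)
    {w : ℝ → ℝ≥0∞} (hw : Measurable w) :
    ∫⁻ y in Ioi (0:ℝ), ENNReal.ofReal (Real.exp (-(x * y ^ lam))) * w y =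
      ∫⁻ u in Ioi (0:ℝ), ENNReal.ofReal (x * Real.exp (-(x * u))) *
        ∫⁻ y in Ioo (0:ℝ) (u ^ lam⁻¹), w y := by
  have h1 : ∀ y ∈ Ioi (0:ℝ), ENNReal.ofReal (Real.exp (-(x * y ^ lam))) * w y =
      ∫⁻ u in Ioi (0:ℝ), {p : ℝ × ℝ | p.1 ^ lam < p.2}.indicator
        (fun p => ENNReal.ofReal (x * Real.exp (-(x * p.2))) * w p.1) (y, u) := by
    intro y hy
    have hy : 0 < y := hy
    have hp : 0 < y ^ lam := Real.rpow_pos_of_pos hy _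
    have : ∀ u, {p : ℝ × ℝ | p.1 ^ lam < p.2}.indicator
        (fun p => ENNReal.ofReal (x * Real.exp (-(x * p.2))) * w p.1) (y, u) =
        (Ioi (y ^ lam)).indicator
          (fun u => ENNReal.ofReal (x * Real.exp (-(x * u))) * w y) u := by
      intro u; simp [indicator]
    simp_rw [this]
    rw [lintegral_indicator measurableSet_Ioi, Measure.restrict_restrict measurableSet_Ioi,
      inter_eq_left.2 (Ioi_subset_Ioi hp.le), lintegral_mul_const _ (by fun_prop)]
    congr 1
    simp_rw [ENNReal.ofReal_mul hx.le]
    rw [lintegral_const_mul _ (by fun_prop), lintegral_exp_neg_mul_Ioi hx,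
      ← ENNReal.ofReal_mul hx.le]
    congr 1
    field_simp
  have hS : MeasurableSet {p : ℝ × ℝ | p.1 ^ lam < p.2} :=
    measurableSet_lt (by fun_prop) (by fun_prop)
  rw [setLIntegral_congr_fun measurableSet_Ioi h1, lintegral_lintegral_swap]
  · refine setLIntegral_congr_fun measurableSet_Ioi fun u hu => ?_
    have hu : 0 < u := hu
    rw [← lintegral_const_mul _ hw, ← lintegral_indicator measurableSet_Ioo,
      ← lintegral_indicator measurableSet_Ioi]
    congr 1
    ext y
    by_cases hy : 0 < y
    · have : y < u ^ lam⁻¹ ↔ y ^ lam < u := Real.lt_rpow_inv_iff_of_pos hy.le hu.le hlam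
      simp [indicator, hy, this]
    · simp [indicator, hy]
  · exact (Measurable.indicator (by fun_prop) hS).aemeasurable

/-- Jensen's inequality for a density of total mass one. -/
lemma rpow_lintegral_mul_le {α : Type*} [MeasurableSpace α] {μ : Measure α} {k h : α → ℝ≥0∞}
    (hk : Measurable k) (hh : Measurable h) (hk1 : ∫⁻ a, k a ∂μ = 1) {q : ℝ} (hq : 1 ≤ q) :
    (∫⁻ a, k a * h a ∂μ) ^ q ≤ ∫⁻ a, k a * h a ^ q ∂μ := by
  have hprob : IsProbabilityMeasure (μ.withDensity k) := ⟨by simpa using hk1⟩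
  have hq0 : 0 < q := by linarith
  have h := eLpNorm'_le_eLpNorm'_of_exponent_le one_pos hq (μ.withDensity k)
    (f := h) hh.aestronglyMeasurable
  simp only [eLpNorm', enorm_eq_self, ENNReal.rpow_one, div_one] at h
  rw [lintegral_withDensity_eq_lintegral_mul _ hk hh,
    lintegral_withDensity_eq_lintegral_mul _ hk (hh.pow_const _)] at h
  rw [ENNReal.le_rpow_inv_iff hq0 |>.symm]
  simpa using h

lemma monotone_lintegral_Ioo (w : ℝ → ℝ≥0∞) : Monotone fun t => ∫⁻ y in Ioo (0:ℝ) t, w y :=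
  fun _ _ h => lintegral_mono_set (Ioo_subset_Ioo_right h)

lemma rpow_lintegral_Ioo_le_of_bounded {r : ℝ → ℝ} (hr : Measurable r) (h0 : ∀ y, 0 ≤ r y) {K : ℝ}
    (hK : ∀ y, r y ≤ K) {q : ℝ} (hq : 1 ≤ q) {t : ℝ} (ht : 0 < t) :
    (∫⁻ y in Ioo (0:ℝ) t, ENNReal.ofReal (r y)) ^ q ≤
      2 ^ q * ∫⁻ s in Ioo (0:ℝ) t,
        (∫⁻ y in Ioo (0:ℝ) s, ENNReal.ofReal (r y)) ^ (q - 1) * ENNReal.ofReal (r s) := by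
  set W : ℝ → ℝ≥0∞ := fun s => ∫⁻ y in Ioo (0:ℝ) s, ENNReal.ofReal (r y) with hW
  have hii : ∀ a b, IntervalIntegrable r volume a b := fun a b =>
    (intervalIntegrable_const (c := K)).mono_fun hr.aestronglyMeasurable
      (ae_of_all _ fun y => by
        beta_reduce
        rw [Real.norm_of_nonneg (h0 y), Real.norm_of_nonneg ((h0 y).trans (hK y))]; exact hK y)
  have hWeq : ∀ s, 0 ≤ s → W s = ENNReal.ofReal (∫ y in (0:ℝ)..s, r y) := by
    intro s hs
    rw [intervalIntegral.integral_of_le hs, ofReal_integral_eq_lintegral_ofReal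
      ((intervalIntegrable_iff_integrableOn_Ioc_of_le hs).1 (hii 0 s)) (ae_of_all _ h0)]
    exact setLIntegral_congr Ioo_ae_eq_Ioc
  have hcont : ContinuousOn W (Icc 0 t) :=
    (ENNReal.continuous_ofReal.comp
      (intervalIntegral.continuous_primitive hii 0)).continuousOn.congr fun s hs => hWeq s hs.1
  have hfin : W t ≠ ∞ := by rw [hWeq t ht.le]; exact ENNReal.ofReal_ne_top
  have hmono : Monotone W := monotone_lintegral_Ioo _
  obtain ⟨s, ⟨hs0, hst⟩, hs⟩ := intermediate_value_Icc ht.le hcont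
    (show W t / 2 ∈ Icc (W 0) (W t) from ⟨by simp [hW], ENNReal.half_le_self⟩)
  have hsplit : W t ≤ W s + ∫⁻ y in Ico s t, ENNReal.ofReal (r y) := by
    refine (lintegral_mono_set ?_).trans (lintegral_union_le _ (Ioo 0 s) (Ico s t))
    intro y hy
    rcases lt_or_ge y s with h | h
    · exact Or.inl ⟨hy.1, h⟩
    · exact Or.inr ⟨h, hy.2⟩
  have hhalf : W t / 2 ≤ ∫⁻ y in Ico s t, ENNReal.ofReal (r y) := by
    rw [hs] at hsplit
    have : W t / 2 + W t / 2 ≤ W t / 2 + ∫⁻ y in Ico s t, ENNReal.ofReal (r y) := by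
      rwa [ENNReal.add_halves]
    exact (ENNReal.add_le_add_iff_left (ENNReal.div_ne_top hfin (by simp))).1 this
  have hIco : ∫⁻ y in Ico s t, ENNReal.ofReal (r y) = ∫⁻ y in Ioo s t, ENNReal.ofReal (r y) :=
    setLIntegral_congr Ioo_ae_eq_Ico.symm
  have key : (W t / 2) ^ q ≤ ∫⁻ s in Ioo (0:ℝ) t, W s ^ (q - 1) * ENNReal.ofReal (r s) :=
    calc (W t / 2) ^ q = (W t / 2) ^ (q - 1) * (W t / 2) := by
          conv_lhs => rw [show q = (q - 1) + 1 by ring]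
          rw [ENNReal.rpow_add_of_nonneg _ _ (by linarith) zero_le_one, ENNReal.rpow_one]
      _ ≤ (W t / 2) ^ (q - 1) * ∫⁻ y in Ioo s t, ENNReal.ofReal (r y) := by
          rw [← hIco]; gcongr
      _ = ∫⁻ y in Ioo s t, (W t / 2) ^ (q - 1) * ENNReal.ofReal (r y) :=
          (lintegral_const_mul _ (by fun_prop)).symm
      _ ≤ ∫⁻ y in Ioo s t, W y ^ (q - 1) * ENNReal.ofReal (r y) := by
          refine setLIntegral_mono' measurableSet_Ioo fun y hy => ?_
          rw [← hs]
          gcongr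
          exact hmono hy.1.le
      _ ≤ _ := lintegral_mono_set (Ioo_subset_Ioo_left hs0)
  calc W t ^ q = 2 ^ q * (W t / 2) ^ q := by
        rw [← ENNReal.mul_rpow_of_nonneg _ _ (by linarith), ENNReal.mul_div_cancel] <;> simp
    _ ≤ _ := by gcongr

lemma iSup_ofReal_min_natCast (a : ℝ) :
    ⨆ n : ℕ, ENNReal.ofReal (min a n) = ENNReal.ofReal a := by
  refine le_antisymm (iSup_le fun n => ENNReal.ofReal_le_ofReal (min_le_left _ _)) ?_
  obtain ⟨n, hn⟩ := exists_nat_ge a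
  refine le_iSup_of_le n ?_
  rw [min_eq_left hn]

lemma rpow_lintegral_Ioo_le {v : ℝ → ℝ} (hv : Measurable v) (h0 : ∀ y, 0 ≤ v y)
    {q : ℝ} (hq : 1 ≤ q) {t : ℝ} (ht : 0 < t) :
    (∫⁻ y in Ioo (0:ℝ) t, ENNReal.ofReal (v y)) ^ q ≤
      2 ^ q * ∫⁻ s in Ioo (0:ℝ) t,
        (∫⁻ y in Ioo (0:ℝ) s, ENNReal.ofReal (v y)) ^ (q - 1) * ENNReal.ofReal (v s) := by
  have hq0 : 0 < q := by linarith
  have hsup : ∫⁻ y in Ioo (0:ℝ) t, ENNReal.ofReal (v y) =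
      ⨆ n : ℕ, ∫⁻ y in Ioo (0:ℝ) t, ENNReal.ofReal (min (v y) n) := by
    rw [← lintegral_iSup (fun n => by fun_prop)]
    · simp_rw [iSup_ofReal_min_natCast]
    · intro m n hmn y
      simp only
      gcongr
  rw [hsup, ← ENNReal.le_rpow_inv_iff hq0]
  refine iSup_le fun n => ?_
  rw [ENNReal.le_rpow_inv_iff hq0]
  refine (rpow_lintegral_Ioo_le_of_bounded (r := fun y => min (v y) n) (by fun_prop)
    (fun y => le_min (h0 y) n.cast_nonneg) (fun y => min_le_right _ _) hq ht).trans ?_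
  gcongr
  · exact min_le_left _ _
  · exact min_le_left _ _

/-- The Laplace-type transform of the weight, as an extended non-negative number. -/
def lapWeight (lam : ℝ) (v : ℝ → ℝ) (x : ℝ) : ℝ≥0∞ :=
  ∫⁻ y in Ioi (0:ℝ), ENNReal.ofReal (Real.exp (-(x * y ^ lam))) * ENNReal.ofReal (v y)

lemma measurable_lapWeight {lam : ℝ} {v : ℝ → ℝ} (hv : Measurable v) :
    Measurable (lapWeight lam v) := by
  unfold lapWeight
  exact Measurable.lintegral_prod_right (by fun_prop)

lemma lintegral_lapWeight_rpow_le {lam q : ℝ} (hlam : 0 < lam) (hq : 1 ≤ q) {v : ℝ → ℝ}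
    (hv : Measurable v) (h0 : ∀ y, 0 ≤ v y) :
    ∫⁻ x in Ioi (0:ℝ), lapWeight lam v x ^ q ≤
      2 ^ q * ∫⁻ t in Ioi (0:ℝ), ENNReal.ofReal t ^ (-lam) *
        ((∫⁻ y in Ioo (0:ℝ) t, ENNReal.ofReal (v y)) ^ (q - 1) * ENNReal.ofReal (v t)) := by
  set V : ℝ → ℝ≥0∞ := fun t => ∫⁻ y in Ioo (0:ℝ) t, ENNReal.ofReal (v y) with hV
  have hVm : Measurable V := (monotone_lintegral_Ioo _).measurable
  have hwm : Measurable fun t => V t ^ (q - 1) * ENNReal.ofReal (v t) := by fun_prop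
  have h2 : (2:ℝ≥0∞) ^ q ≠ ∞ := ENNReal.rpow_ne_top_of_nonneg (by linarith) (by simp)
  have hpt : ∀ x ∈ Ioi (0:ℝ), lapWeight lam v x ^ q ≤
      2 ^ q * ∫⁻ y in Ioi (0:ℝ), ENNReal.ofReal (Real.exp (-(1 * (x * y ^ lam)))) *
        (V y ^ (q - 1) * ENNReal.ofReal (v y)) := by
    intro x hx
    have hx : 0 < x := hx
    simp_rw [one_mul]
    rw [lapWeight, lintegral_exp_neg_mul_rpow_eq hlam hx (by fun_prop),
      lintegral_exp_neg_mul_rpow_eq hlam hx hwm]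
    refine (rpow_lintegral_mul_le (by fun_prop)
      (hVm.comp (g := V) (f := fun u : ℝ => u ^ lam⁻¹) (by fun_prop)) ?_ hq).trans ?_
    · simp_rw [ENNReal.ofReal_mul hx.le]
      rw [lintegral_const_mul _ (by fun_prop), lintegral_exp_neg_mul_Ioi hx,
        ← ENNReal.ofReal_mul hx.le]
      simp [hx.ne']
    · rw [← lintegral_const_mul' _ _ h2]
      refine setLIntegral_mono' measurableSet_Ioi fun u hu => ?_
      rw [mul_left_comm]
      gcongr
      exact rpow_lintegral_Ioo_le hv h0 hq (Real.rpow_pos_of_pos hu _)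
  refine (setLIntegral_mono' measurableSet_Ioi hpt).trans ?_
  rw [lintegral_const_mul' _ _ h2, lintegral_lintegral_exp_neg_mul_rpow one_pos hwm]
  simp [hV]

lemma le_lintegral_lapWeight_rpow {lam q : ℝ} (hlam : 0 < lam) (hq : 1 ≤ q) {v : ℝ → ℝ}
    (hv : Measurable v) :
    ENNReal.ofReal (1 / q) * ∫⁻ t in Ioi (0:ℝ), ENNReal.ofReal t ^ (-lam) *
        ((∫⁻ y in Ioo (0:ℝ) t, ENNReal.ofReal (v y)) ^ (q - 1) * ENNReal.ofReal (v t)) ≤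
      ∫⁻ x in Ioi (0:ℝ), lapWeight lam v x ^ q := by
  set V : ℝ → ℝ≥0∞ := fun t => ∫⁻ y in Ioo (0:ℝ) t, ENNReal.ofReal (v y) with hV
  have hVm : Measurable V := (monotone_lintegral_Ioo _).measurable
  have hwm : Measurable fun t => V t ^ (q - 1) * ENNReal.ofReal (v t) := by fun_prop
  have hq1 : 0 ≤ q - 1 := by linarith
  rw [← lintegral_lintegral_exp_neg_mul_rpow (by linarith) hwm]
  refine setLIntegral_mono' measurableSet_Ioi fun x hx => ?_
  have hx : 0 < x := hx
  have hVle : ∀ y ∈ Ioi (0:ℝ), ENNReal.ofReal (Real.exp (-(x * y ^ lam))) * V y ≤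
      lapWeight lam v x := by
    intro y hy
    rw [← lintegral_const_mul _ (by fun_prop)]
    refine (setLIntegral_mono' measurableSet_Ioo fun z hz => ?_).trans
      (lintegral_mono_set Ioo_subset_Ioi_self)
    have : z ^ lam ≤ y ^ lam := Real.rpow_le_rpow hz.1.le hz.2.le hlam.le
    gcongr
  calc ∫⁻ y in Ioi (0:ℝ), ENNReal.ofReal (Real.exp (-(q * (x * y ^ lam)))) *
        (V y ^ (q - 1) * ENNReal.ofReal (v y))
      ≤ ∫⁻ y in Ioi (0:ℝ), lapWeight lam v x ^ (q - 1) *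
          (ENNReal.ofReal (Real.exp (-(x * y ^ lam))) * ENNReal.ofReal (v y)) := by
        refine setLIntegral_mono' measurableSet_Ioi fun y hy => ?_
        have hexp : ENNReal.ofReal (Real.exp (-(q * (x * y ^ lam)))) =
            ENNReal.ofReal (Real.exp (-(x * y ^ lam))) ^ (q - 1) *
              ENNReal.ofReal (Real.exp (-(x * y ^ lam))) := by
          rw [ENNReal.ofReal_rpow_of_pos (Real.exp_pos _), ← Real.exp_mul,
            ← ENNReal.ofReal_mul (Real.exp_pos _).le, ← Real.exp_add]
          congr 2; ring
        calc _ = (ENNReal.ofReal (Real.exp (-(x * y ^ lam))) * V y) ^ (q - 1) *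
              (ENNReal.ofReal (Real.exp (-(x * y ^ lam))) * ENNReal.ofReal (v y)) := by
              rw [hexp, ENNReal.mul_rpow_of_nonneg _ _ hq1]; ring
          _ ≤ _ := by gcongr; exact hVle y hy
    _ = lapWeight lam v x ^ (q - 1) * lapWeight lam v x := lintegral_const_mul _ (by fun_prop)
    _ = lapWeight lam v x ^ q := by
        conv_rhs => rw [show q = (q - 1) + 1 by ring]
        rw [ENNReal.rpow_add_of_nonneg _ _ hq1 zero_le_one, ENNReal.rpow_one]

lemma lapWeight_anti (lam : ℝ) (v : ℝ → ℝ) {x z : ℝ} (h : z ≤ x) :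
    lapWeight lam v x ≤ lapWeight lam v z := by
  refine setLIntegral_mono' measurableSet_Ioi fun y hy => ?_
  have : 0 ≤ y ^ lam := Real.rpow_nonneg (le_of_lt hy) _
  gcongr

lemma lapWeight_ne_top {lam q : ℝ} (hq : 1 ≤ q) {v : ℝ → ℝ}
    (hfin : ∫⁻ x in Ioi (0:ℝ), lapWeight lam v x ^ q ≠ ∞) {x : ℝ} (hx : 0 < x) :
    lapWeight lam v x ≠ ∞ := by
  intro htop
  refine hfin (top_unique ?_)
  calc (∞ : ℝ≥0∞) = ∫⁻ _ in Ioo 0 x, ∞ := by simp [hx]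
    _ ≤ ∫⁻ z in Ioo 0 x, lapWeight lam v z ^ q := by
        refine setLIntegral_mono' measurableSet_Ioo fun z hz => ?_
        have h := lapWeight_anti lam v hz.2.le
        rw [htop, top_le_iff] at h
        rw [h, ENNReal.top_rpow_of_pos (by linarith)]
    _ ≤ _ := lintegral_mono_set Ioo_subset_Ioi_self

lemma integrableOn_exp_mul_weight {lam : ℝ} {v : ℝ → ℝ} (hv : Measurable v) (h0 : ∀ y, 0 ≤ v y)
    {x : ℝ} (hx : lapWeight lam v x ≠ ∞) :
    IntegrableOn (fun y => Real.exp (-(x * y ^ lam)) * v y) (Ioi 0) := by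
  refine ⟨(by fun_prop : Measurable _).aestronglyMeasurable, ?_⟩
  rw [hasFiniteIntegral_iff_ofReal (ae_of_all _ fun y => mul_nonneg (Real.exp_pos _).le (h0 y))]
  simp_rw [ENNReal.ofReal_mul (Real.exp_pos _).le]
  exact hx.lt_top

lemma ae_abs_le_one {f : ℝ → ℝ} (hf : eNinf f ≤ 1) :
    ∀ᵐ y ∂volume.restrict (Ioi (0:ℝ)), |f y| ≤ 1 := by
  filter_upwards [ENNReal.ae_le_essSup (μ := volume.restrict (Ioi (0:ℝ)))
    (fun x => ENNReal.ofReal |f x|)] with y hy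
  simpa using hy.trans hf

lemma measurable_Lap {lam : ℝ} {v f : ℝ → ℝ} (hv : Measurable v) (hf : Measurable f) :
    Measurable (Lap lam v f) := by
  unfold Lap
  refine (StronglyMeasurable.integral_prod_right (f := fun x y : ℝ =>
    Real.exp (-(x * y ^ lam)) * f y * v y) ?_).measurable
  exact (by fun_prop : Measurable _).stronglyMeasurable

lemma integrableOn_exp_mul_mul_weight {lam : ℝ} {v f : ℝ → ℝ} (hv : Measurable v)
    (h0 : ∀ y, 0 ≤ v y) (hf : Measurable f)
    (hf1 : ∀ᵐ y ∂volume.restrict (Ioi (0:ℝ)), |f y| ≤ 1) {x : ℝ} (hx : lapWeight lam v x ≠ ∞) :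
    IntegrableOn (fun y => Real.exp (-(x * y ^ lam)) * f y * v y) (Ioi 0) := by
  refine (integrableOn_exp_mul_weight hv h0 hx).mono'
    (by fun_prop : Measurable _).aestronglyMeasurable ?_
  filter_upwards [hf1] with y hy
  rw [norm_mul, norm_mul, Real.norm_of_nonneg (h0 y), Real.norm_of_nonneg (Real.exp_pos _).le,
    Real.norm_eq_abs]
  have := h0 y
  calc _ ≤ Real.exp (-(x * y ^ lam)) * 1 * v y := by gcongr
    _ = _ := by rw [mul_one]

lemma ofReal_abs_Lap_le {lam : ℝ} {v f : ℝ → ℝ} (h0 : ∀ y, 0 ≤ v y)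
    (hf1 : ∀ᵐ y ∂volume.restrict (Ioi (0:ℝ)), |f y| ≤ 1) (x : ℝ) :
    ENNReal.ofReal |Lap lam v f x| ≤ lapWeight lam v x := by
  rw [← Real.norm_eq_abs, ofReal_norm, Lap]
  refine (enorm_integral_le_lintegral_enorm _).trans (lintegral_mono_ae ?_)
  filter_upwards [hf1] with y hy
  rw [← ENNReal.ofReal_mul (Real.exp_pos _).le, ← ofReal_norm, norm_mul, norm_mul,
    Real.norm_of_nonneg (h0 y), Real.norm_of_nonneg (Real.exp_pos _).le, Real.norm_eq_abs]
  have := h0 y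
  gcongr
  exact mul_le_of_le_one_right (Real.exp_pos _).le hy

lemma abs_Lap_sub_Lap_le {lam : ℝ} {v f : ℝ → ℝ} (hv : Measurable v)
    (h0 : ∀ y, 0 ≤ v y) (hf : Measurable f)
    (hf1 : ∀ᵐ y ∂volume.restrict (Ioi (0:ℝ)), |f y| ≤ 1) {x r : ℝ}
    (hx : lapWeight lam v x ≠ ∞) (hr : lapWeight lam v r ≠ ∞) :
    |Lap lam v f x - Lap lam v f r| ≤
      ∫ y in Ioi (0:ℝ), |Real.exp (-(x * y ^ lam)) - Real.exp (-(r * y ^ lam))| * v y := by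
  rw [Lap, Lap, ← integral_sub (integrableOn_exp_mul_mul_weight hv h0 hf hf1 hx)
    (integrableOn_exp_mul_mul_weight hv h0 hf hf1 hr), ← Real.norm_eq_abs]
  refine norm_integral_le_of_norm_le ?_ ?_
  · refine ((integrableOn_exp_mul_weight hv h0 hx).sub
      (integrableOn_exp_mul_weight hv h0 hr)).norm.congr (ae_of_all _ fun y => ?_)
    simp only [Pi.sub_apply]
    rw [← sub_mul, norm_mul, Real.norm_of_nonneg (h0 y), Real.norm_eq_abs]
  · filter_upwards [hf1] with y hy
    rw [← sub_mul, ← sub_mul, norm_mul, norm_mul, Real.norm_of_nonneg (h0 y), Real.norm_eq_abs,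
      Real.norm_eq_abs]
    have := h0 y
    gcongr
    exact mul_le_of_le_one_right (abs_nonneg _) hy

lemma tendsto_integral_abs_exp_sub {lam : ℝ} {v : ℝ → ℝ} (hv : Measurable v)
    (h0 : ∀ y, 0 ≤ v y) (hfin : ∀ x, 0 < x → lapWeight lam v x ≠ ∞) {x : ℝ} (hx : 0 < x) :
    Tendsto (fun r => ∫ y in Ioi (0:ℝ),
      |Real.exp (-(x * y ^ lam)) - Real.exp (-(r * y ^ lam))| * v y) (𝓝 x) (𝓝 0) := by
  have hx2 : 0 < x / 2 := by linarith
  have h := tendsto_integral_filter_of_dominated_convergence (μ := volume.restrict (Ioi (0:ℝ)))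
    (l := 𝓝 x) (F := fun r y => |Real.exp (-(x * y ^ lam)) - Real.exp (-(r * y ^ lam))| * v y)
    (f := fun _ => (0:ℝ)) (fun y => 2 * (Real.exp (-(x / 2 * y ^ lam)) * v y))
    (Eventually.of_forall fun r => (by fun_prop : Measurable _).aestronglyMeasurable) ?_
    ((integrableOn_exp_mul_weight hv h0 (hfin _ hx2)).const_mul 2) ?_
  · simpa using h
  · filter_upwards [lt_mem_nhds (show x / 2 < x by linarith)] with r hr
    filter_upwards [ae_restrict_mem measurableSet_Ioi] with y hy
    have hp : 0 ≤ y ^ lam := Real.rpow_nonneg (le_of_lt hy) _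
    have := h0 y
    rw [norm_mul, Real.norm_of_nonneg (h0 y), Real.norm_eq_abs, abs_abs, ← mul_assoc]
    gcongr
    have h1 : Real.exp (-(x * y ^ lam)) ≤ Real.exp (-(x / 2 * y ^ lam)) := by gcongr; linarith
    have h2 : Real.exp (-(r * y ^ lam)) ≤ Real.exp (-(x / 2 * y ^ lam)) := by gcongr
    have h3 := Real.exp_pos (-(x * y ^ lam))
    have h4 := Real.exp_pos (-(r * y ^ lam))
    rw [abs_le]
    constructor <;> linarith
  · refine ae_of_all _ fun y => ?_
    have hc : Continuous fun r : ℝ =>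
        |Real.exp (-(x * y ^ lam)) - Real.exp (-(r * y ^ lam))| * v y := by fun_prop
    simpa using hc.tendsto x

/-- A diagonal extraction: a bounded sequence has a subsequence whose images converge at every
positive point. -/
lemma exists_subseq_cauchySeq_Lap {lam : ℝ} {v : ℝ → ℝ} (hv : Measurable v)
    (h0 : ∀ y, 0 ≤ v y) (hfin : ∀ x, 0 < x → lapWeight lam v x ≠ ∞) {f : ℕ → ℝ → ℝ}
    (hf : ∀ n, Measurable (f n))
    (hf1 : ∀ n, ∀ᵐ y ∂volume.restrict (Ioi (0:ℝ)), |f n y| ≤ 1) :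
    ∃ φ : ℕ → ℕ, StrictMono φ ∧
      ∀ x, 0 < x → CauchySeq fun n => Lap lam v (f (φ n)) x := by
  let ι := {r : ℚ // 0 < r}
  have hpos : ∀ i : ι, (0:ℝ) < (i.1 : ℝ) := fun i => by exact_mod_cast i.2
  let K : Set (ι → ℝ) := Set.pi univ fun i =>
    Icc (-(lapWeight lam v i.1).toReal) (lapWeight lam v i.1).toReal
  have hK : IsCompact K := isCompact_univ_pi fun i => isCompact_Icc
  obtain ⟨a, -, φ, hφ, ha⟩ := hK.tendsto_subseq
    (x := fun n (i : ι) => Lap lam v (f n) (i.1 : ℝ)) (by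
      intro n i _
      refine abs_le.1 ?_
      exact (ENNReal.ofReal_le_iff_le_toReal (hfin _ (hpos i))).1 (ofReal_abs_Lap_le h0 (hf1 n) _))
  refine ⟨φ, hφ, fun x hx => Metric.cauchySeq_iff.2 fun ε hε => ?_⟩
  have hclose : ∀ᶠ r in 𝓝 x, 0 < r ∧ ∫ y in Ioi (0:ℝ),
      |Real.exp (-(x * y ^ lam)) - Real.exp (-(r * y ^ lam))| * v y < ε / 3 :=
    (lt_mem_nhds hx).and
      ((tendsto_integral_abs_exp_sub hv h0 hfin hx).eventually (gt_mem_nhds (by positivity)))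
  obtain ⟨r, hr, hrε⟩ : ∃ r : ℚ, 0 < (r:ℝ) ∧ ∫ y in Ioi (0:ℝ),
      |Real.exp (-(x * y ^ lam)) - Real.exp (-((r:ℝ) * y ^ lam))| * v y < ε / 3 := by
    obtain ⟨r, hr⟩ := (Rat.denseRange_cast (𝕜 := ℝ)).exists_mem_open isOpen_interior
      ⟨x, mem_interior_iff_mem_nhds.2 hclose⟩
    have hr' := interior_subset hr
    exact ⟨r, hr'⟩
  have hcr : CauchySeq fun n => Lap lam v (f (φ n)) r :=
    ((tendsto_pi_nhds.1 ha) ⟨r, by exact_mod_cast hr⟩).cauchySeq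
  obtain ⟨N, hN⟩ := Metric.cauchySeq_iff.1 hcr (ε / 3) (by positivity)
  refine ⟨N, fun m hm n hn => ?_⟩
  have hmn := hN m hm n hn
  have hxr : ∀ k, |Lap lam v (f (φ k)) x - Lap lam v (f (φ k)) r| < ε / 3 := fun k =>
    (abs_Lap_sub_Lap_le hv h0 (hf _) (hf1 _) (hfin x hx) (hfin r hr)).trans_lt hrε
  have h1 := abs_lt.1 (hxr m)
  have h2 := abs_lt.1 (hxr n)
  rw [Real.dist_eq, abs_lt] at hmn ⊢
  constructor <;> linarith

lemma lapCompact_of_lintegral_ne_top {lam q : ℝ} (hq : 1 ≤ q) {v : ℝ → ℝ}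
    (hv : Measurable v) (h0 : ∀ y, 0 ≤ v y)
    (hfin : ∫⁻ x in Ioi (0:ℝ), lapWeight lam v x ^ q ≠ ∞) : LapCompactInftyTo lam q v := by
  intro f hf hf1
  have hq0 : 0 < q := by linarith
  replace hf1 := fun n => ae_abs_le_one (hf1 n)
  obtain ⟨φ, hφ, hc⟩ := exists_subseq_cauchySeq_Lap hv h0
    (fun x hx => lapWeight_ne_top hq hfin hx) hf hf1
  refine ⟨φ, hφ, fun ε hε => ?_⟩
  have hint := tendsto_lintegral_filter_of_dominated_convergence
    (μ := volume.restrict (Ioi (0:ℝ))) (l := (atTop : Filter (ℕ × ℕ)))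
    (F := fun p x => ENNReal.ofReal |Lap lam v (f (φ p.1)) x - Lap lam v (f (φ p.2)) x| ^ q)
    (f := fun _ => 0) (fun x => 2 ^ q * lapWeight lam v x ^ q) ?_ ?_ ?_ ?_
  · have hN : Tendsto (fun p : ℕ × ℕ =>
        eN q (fun x => Lap lam v (f (φ p.1)) x - Lap lam v (f (φ p.2)) x)) atTop (𝓝 0) := by
      have := (ENNReal.continuous_rpow_const (y := 1 / q)).tendsto 0 |>.comp
        (by simpa using hint)
      simpa [eN, Function.comp_def, ENNReal.zero_rpow_of_pos (inv_pos.2 hq0)] using this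
    obtain ⟨⟨N₁, N₂⟩, h⟩ := eventually_atTop.1
      (hN.eventually (gt_mem_nhds (ENNReal.ofReal_pos.2 hε)))
    exact ⟨max N₁ N₂, fun m hm n hn =>
      h (m, n) ⟨(le_max_left _ _).trans hm, (le_max_right _ _).trans hn⟩⟩
  · refine Eventually.of_forall fun p => ?_
    have h1 := measurable_Lap (lam := lam) hv (hf (φ p.1))
    have h2 := measurable_Lap (lam := lam) hv (hf (φ p.2))
    fun_prop
  · refine Eventually.of_forall fun p => ae_of_all _ fun x => ?_
    rw [← ENNReal.mul_rpow_of_nonneg _ _ hq0.le]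
    gcongr
    calc ENNReal.ofReal |Lap lam v (f (φ p.1)) x - Lap lam v (f (φ p.2)) x|
        ≤ ENNReal.ofReal (|Lap lam v (f (φ p.1)) x| + |Lap lam v (f (φ p.2)) x|) := by
          gcongr; exact abs_sub _ _
      _ ≤ _ := ENNReal.ofReal_add_le
      _ ≤ lapWeight lam v x + lapWeight lam v x :=
          add_le_add (ofReal_abs_Lap_le h0 (hf1 _) x) (ofReal_abs_Lap_le h0 (hf1 _) x)
      _ = _ := (two_mul _).symm
  · rw [lintegral_const_mul _ ((measurable_lapWeight hv).pow_const _)]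
    exact ENNReal.mul_ne_top (ENNReal.rpow_ne_top_of_nonneg hq0.le (by simp)) hfin
  · filter_upwards [ae_restrict_mem measurableSet_Ioi] with x hx
    have h := cauchySeq_iff_tendsto_dist_atTop_0.1 (hc x hx)
    have h2 := (ENNReal.continuous_rpow_const (y := q)).tendsto 0 |>.comp
      (by simpa using ENNReal.tendsto_ofReal h)
    simpa [ENNReal.zero_rpow_of_pos hq0, Real.dist_eq] using! h2

/-- The truncation of the weight to height `n + 1` on the interval `(1 / (n + 1), n + 1)`. -/
def truncWeight (v : ℝ → ℝ) (n : ℕ) : ℝ → ℝ :=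
  (Ioo (1 / ((n:ℝ) + 1)) ((n:ℝ) + 1)).indicator fun y => min (v y) (n + 1)

section truncWeight

variable {lam : ℝ} {v : ℝ → ℝ}

lemma measurable_truncWeight (hv : Measurable v) (n : ℕ) : Measurable (truncWeight v n) :=
  Measurable.indicator (by fun_prop) measurableSet_Ioo

lemma truncWeight_nonneg (h0 : ∀ y, 0 ≤ v y) (n : ℕ) (y : ℝ) : 0 ≤ truncWeight v n y :=
  indicator_nonneg (fun y _ => le_min (h0 y) (by positivity)) y

lemma truncWeight_le (h0 : ∀ y, 0 ≤ v y) (n : ℕ) (y : ℝ) : truncWeight v n y ≤ v y := by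
  unfold truncWeight indicator
  split_ifs
  · exact min_le_left _ _
  · exact h0 y

lemma truncWeight_mono (h0 : ∀ y, 0 ≤ v y) (y : ℝ) : Monotone fun n => truncWeight v n y := by
  intro m n hmn
  have hmn' : (m:ℝ) ≤ n := by exact_mod_cast hmn
  have hsub : Ioo (1 / ((m:ℝ) + 1)) ((m:ℝ) + 1) ⊆ Ioo (1 / ((n:ℝ) + 1)) ((n:ℝ) + 1) :=
    Ioo_subset_Ioo (by gcongr) (by gcongr)
  by_cases hy : y ∈ Ioo (1 / ((m:ℝ) + 1)) ((m:ℝ) + 1)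
  · simp only [truncWeight, indicator_of_mem hy, indicator_of_mem (hsub hy)]
    gcongr
  · refine le_trans (le_of_eq ?_) (truncWeight_nonneg h0 n y)
    exact indicator_of_notMem hy _

lemma exists_truncWeight_eq {y : ℝ} (hy : 0 < y) : ∃ n, truncWeight v n y = v y := by
  obtain ⟨n, hn⟩ := exists_nat_gt (max (v y) (max y (1 / y)))
  obtain ⟨h1, h2, h3⟩ : v y < n ∧ y < n ∧ 1 / y < n := by simpa using hn
  refine ⟨n, ?_⟩
  rw [truncWeight, indicator_of_mem, min_eq_left (by linarith)]
  refine ⟨?_, by linarith⟩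
  rw [one_div_lt (by positivity) hy]
  linarith

lemma iSup_ofReal_truncWeight (h0 : ∀ y, 0 ≤ v y) {y : ℝ} (hy : 0 < y) :
    ⨆ n, ENNReal.ofReal (truncWeight v n y) = ENNReal.ofReal (v y) := by
  refine le_antisymm (iSup_le fun n => ENNReal.ofReal_le_ofReal (truncWeight_le h0 n y)) ?_
  obtain ⟨n, hn⟩ := exists_truncWeight_eq (v := v) hy
  exact le_iSup_of_le n (by rw [hn])

lemma lapWeight_truncWeight_mono (h0 : ∀ y, 0 ≤ v y) (x : ℝ) :
    Monotone fun n => lapWeight lam (truncWeight v n) x := by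
  intro m n hmn
  refine lintegral_mono fun y => ?_
  have := truncWeight_mono h0 y hmn
  gcongr

lemma iSup_lapWeight_truncWeight (hv : Measurable v) (h0 : ∀ y, 0 ≤ v y) (x : ℝ) :
    ⨆ n, lapWeight lam (truncWeight v n) x = lapWeight lam v x := by
  unfold lapWeight
  rw [← lintegral_iSup]
  · refine setLIntegral_congr_fun measurableSet_Ioi fun y hy => ?_
    rw [← ENNReal.mul_iSup, iSup_ofReal_truncWeight h0 hy]
  · intro n
    have := measurable_truncWeight hv n
    fun_prop
  · intro m n hmn y
    have := truncWeight_mono h0 y hmn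
    simp only at this ⊢
    gcongr

lemma lapWeight_truncWeight_le (hlam : 0 < lam) (n : ℕ) {x : ℝ} (hx : 0 < x) :
    lapWeight lam (truncWeight v n) x ≤
      ENNReal.ofReal ((n + 1) * (n + 1) * Real.exp (-(x * (1 / ((n:ℝ) + 1)) ^ lam))) := by
  have hn : (0:ℝ) < n + 1 := by positivity
  calc lapWeight lam (truncWeight v n) x
      ≤ ∫⁻ y in Ioi (0:ℝ), (Ioo (1 / ((n:ℝ) + 1)) ((n:ℝ) + 1)).indicator (fun _ =>
          ENNReal.ofReal ((n + 1) * Real.exp (-(x * (1 / ((n:ℝ) + 1)) ^ lam)))) y := by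
        refine lintegral_mono fun y => ?_
        by_cases hy : y ∈ Ioo (1 / ((n:ℝ) + 1)) ((n:ℝ) + 1)
        · rw [truncWeight, indicator_of_mem hy, indicator_of_mem hy, mul_comm,
            ENNReal.ofReal_mul hn.le]
          have : (1 / ((n:ℝ) + 1)) ^ lam ≤ y ^ lam :=
            Real.rpow_le_rpow (by positivity) hy.1.le hlam.le
          gcongr
          exact min_le_right _ _
        · rw [truncWeight, indicator_of_notMem hy, indicator_of_notMem hy]
          simp
    _ ≤ ∫⁻ y, (Ioo (1 / ((n:ℝ) + 1)) ((n:ℝ) + 1)).indicator (fun _ =>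
          ENNReal.ofReal ((n + 1) * Real.exp (-(x * (1 / ((n:ℝ) + 1)) ^ lam)))) y :=
        setLIntegral_le_lintegral _ _
    _ = ENNReal.ofReal ((n + 1) * Real.exp (-(x * (1 / ((n:ℝ) + 1)) ^ lam))) *
          ENNReal.ofReal ((n + 1) - 1 / ((n:ℝ) + 1)) := by
        rw [lintegral_indicator measurableSet_Ioo, setLIntegral_const, Real.volume_Ioo]
    _ ≤ ENNReal.ofReal ((n + 1) * Real.exp (-(x * (1 / ((n:ℝ) + 1)) ^ lam))) *
          ENNReal.ofReal (n + 1) := by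
        gcongr
        have : 0 ≤ 1 / ((n:ℝ) + 1) := by positivity
        linarith
    _ = _ := by
        rw [← ENNReal.ofReal_mul (by positivity)]
        congr 1; ring

lemma lintegral_lapWeight_truncWeight_rpow_ne_top (hlam : 0 < lam) {q : ℝ} (hq : 0 < q) (n : ℕ) :
    ∫⁻ x in Ioi (0:ℝ), lapWeight lam (truncWeight v n) x ^ q ≠ ∞ := by
  have hn : (0:ℝ) < n + 1 := by positivity
  set a : ℝ := (1 / ((n:ℝ) + 1)) ^ lam with ha
  have ha0 : 0 < a := by positivity
  refine ne_top_of_le_ne_top (b := ∫⁻ x in Ioi (0:ℝ),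
    ENNReal.ofReal (((n + 1) * (n + 1)) ^ q) * ENNReal.ofReal (Real.exp (-((q * a) * x)))) ?_ ?_
  · rw [lintegral_const_mul _ (by fun_prop), lintegral_exp_neg_mul_Ioi (by positivity)]
    exact ENNReal.mul_ne_top ENNReal.ofReal_ne_top ENNReal.ofReal_ne_top
  · refine setLIntegral_mono' measurableSet_Ioi fun x hx => ?_
    refine (ENNReal.rpow_le_rpow (lapWeight_truncWeight_le hlam n hx) hq.le).trans (le_of_eq ?_)
    rw [ENNReal.ofReal_rpow_of_nonneg (by positivity) hq.le,
      Real.mul_rpow (by positivity) (by positivity), ENNReal.ofReal_mul (by positivity),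
      ← Real.exp_mul]
    congr 3
    ring

lemma ofReal_abs_Lap_truncWeight (hlam : 0 < lam) (hv : Measurable v) (h0 : ∀ y, 0 ≤ v y)
    (n : ℕ) {x : ℝ} (hx : 0 < x) :
    ENNReal.ofReal |Lap lam v (fun y => truncWeight v n y / v y) x| =
      lapWeight lam (truncWeight v n) x := by
  have hfin : lapWeight lam (truncWeight v n) x ≠ ∞ :=
    ne_top_of_le_ne_top ENNReal.ofReal_ne_top (lapWeight_truncWeight_le hlam n hx)
  have hi := integrableOn_exp_mul_weight (measurable_truncWeight hv n) (truncWeight_nonneg h0 n)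
    hfin
  have hnn : ∀ y, 0 ≤ Real.exp (-(x * y ^ lam)) * truncWeight v n y := fun y =>
    mul_nonneg (Real.exp_pos _).le (truncWeight_nonneg h0 n y)
  have heq : Lap lam v (fun y => truncWeight v n y / v y) x =
      ∫ y in Ioi (0:ℝ), Real.exp (-(x * y ^ lam)) * truncWeight v n y := by
    unfold Lap
    congr 1
    ext y
    rw [mul_assoc]
    congr 1
    refine div_mul_cancel_of_imp fun hy => le_antisymm ?_ (truncWeight_nonneg h0 n y)
    exact (truncWeight_le h0 n y).trans hy.le
  rw [heq, abs_of_nonneg (integral_nonneg hnn),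
    ofReal_integral_eq_lintegral_ofReal hi (ae_of_all _ hnn), lapWeight]
  simp_rw [ENNReal.ofReal_mul (Real.exp_pos _).le]

lemma eN_Lap_truncWeight (hlam : 0 < lam) (hv : Measurable v) (h0 : ∀ y, 0 ≤ v y) (q : ℝ) (n : ℕ) :
    eN q (Lap lam v fun y => truncWeight v n y / v y) =
      (∫⁻ x in Ioi (0:ℝ), lapWeight lam (truncWeight v n) x ^ q) ^ (1 / q) := by
  unfold eN
  congr 1
  refine setLIntegral_congr_fun measurableSet_Ioi fun x hx => ?_
  simp only [ofReal_abs_Lap_truncWeight hlam hv h0 n hx]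

end truncWeight

lemma eN_le_eN_sub_add {q : ℝ} (hq : 1 ≤ q) {g h : ℝ → ℝ} (hg : Measurable g)
    (hh : Measurable h) : eN q g ≤ eN q (fun x => g x - h x) + eN q h := by
  unfold eN
  refine le_trans ?_ (ENNReal.lintegral_Lp_add_le (by fun_prop) (by fun_prop) hq)
  gcongr with x
  rw [Pi.add_apply, ← ENNReal.ofReal_add (abs_nonneg _) (abs_nonneg _)]
  gcongr
  have := abs_add_le (g x - h x) (h x)
  rwa [sub_add_cancel] at this

lemma lintegral_ne_top_of_lapCompact {lam q : ℝ} (hlam : 0 < lam) (hq : 1 ≤ q) {v : ℝ → ℝ}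
    (hv : Measurable v) (h0 : ∀ y, 0 ≤ v y) (hcomp : LapCompactInftyTo lam q v) :
    ∫⁻ x in Ioi (0:ℝ), lapWeight lam v x ^ q ≠ ∞ := by
  have hq0 : 0 < q := by linarith
  have hfm : ∀ n, Measurable fun y => truncWeight v n y / v y := fun n =>
    (measurable_truncWeight hv n).div hv
  obtain ⟨φ, hφ, hc⟩ := hcomp (fun n y => truncWeight v n y / v y) hfm (by
    intro n
    refine essSup_le_of_ae_le _ (ae_of_all _ fun y => ?_)
    simp only
    rw [abs_of_nonneg (div_nonneg (truncWeight_nonneg h0 n y) (h0 y))]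
    exact ENNReal.ofReal_le_one.2 (div_le_one_of_le₀ (truncWeight_le h0 n y) (h0 y)))
  obtain ⟨N, hN⟩ := hc 1 one_pos
  set C : ℝ≥0∞ := 1 + (∫⁻ x in Ioi (0:ℝ), lapWeight lam (truncWeight v (φ N)) x ^ q) ^ (1 / q)
    with hC
  have hCfin : C ≠ ∞ := ENNReal.add_ne_top.2 ⟨ENNReal.one_ne_top,
    ENNReal.rpow_ne_top_of_nonneg (by positivity)
      (lintegral_lapWeight_truncWeight_rpow_ne_top hlam hq0 _)⟩
  have hmono : ∀ x, Monotone fun n => lapWeight lam (truncWeight v n) x ^ q := fun x m n hmn =>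
    ENNReal.rpow_le_rpow (lapWeight_truncWeight_mono h0 x hmn) hq0.le
  have hbound : ∀ n, ∫⁻ x in Ioi (0:ℝ), lapWeight lam (truncWeight v n) x ^ q ≤ C ^ q := by
    intro n
    have h1 : (∫⁻ x in Ioi (0:ℝ), lapWeight lam (truncWeight v (φ (max n N))) x ^ q) ^ (1 / q) ≤
        C := by
      rw [hC, ← eN_Lap_truncWeight hlam hv h0, ← eN_Lap_truncWeight hlam hv h0]
      refine (eN_le_eN_sub_add hq (measurable_Lap hv (hfm _))
        (measurable_Lap (lam := lam) hv (hfm (φ N)))).trans ?_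
      gcongr
      simpa using (hN (max n N) (le_max_right _ _) N le_rfl).le
    rw [one_div, ENNReal.rpow_inv_le_iff hq0] at h1
    refine le_trans (lintegral_mono fun x => ?_) h1
    exact hmono x ((le_max_left n N).trans hφ.le_apply)
  refine ne_top_of_le_ne_top (ENNReal.rpow_ne_top_of_nonneg hq0.le hCfin) ?_
  calc ∫⁻ x in Ioi (0:ℝ), lapWeight lam v x ^ q
      = ∫⁻ x in Ioi (0:ℝ), ⨆ n, lapWeight lam (truncWeight v n) x ^ q := by
        congr 1
        ext x
        rw [← iSup_lapWeight_truncWeight hv h0]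
        exact (ENNReal.orderIsoRpow q hq0).map_iSup _
    _ = ⨆ n, ∫⁻ x in Ioi (0:ℝ), lapWeight lam (truncWeight v n) x ^ q :=
        lintegral_iSup
          (fun n => (measurable_lapWeight (measurable_truncWeight hv n)).pow_const _)
          (fun m n hmn x => hmono x hmn)
    _ ≤ C ^ q := iSup_le hbound

theorem stmt18 (lam q : ℝ) (hlam : 0 < lam) (hq : 1 ≤ q)
    (v : ℝ → ℝ) (hv : Measurable v) (hvpos : ∀ y, 0 ≤ v y)
    (Cq : ℝ≥0∞)
    (hCq : Cq = if q = 1 then ∫⁻ y in Ioi (0:ℝ), (ENNReal.ofReal y) ^ (-lam) * ENNReal.ofReal (v y)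
      else (∫⁻ t in Ioi (0:ℝ), (ENNReal.ofReal t) ^ (-lam)
        * (∫⁻ y in Ioo (0:ℝ) t, ENNReal.ofReal (v y)) ^ (q - 1)
        * ENNReal.ofReal (v t)) ^ (1/q)) :
    LapCompactInftyTo lam q v ↔ Cq < ⊤ := by
  have hq0 : 0 < q := by linarith
  have hC : Cq = (∫⁻ t in Ioi (0:ℝ), ENNReal.ofReal t ^ (-lam) *
      ((∫⁻ y in Ioo (0:ℝ) t, ENNReal.ofReal (v y)) ^ (q - 1) * ENNReal.ofReal (v t))) ^ (1/q) := by
    rw [hCq]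
    split_ifs with h
    · simp [h]
    · simp_rw [mul_assoc]
  rw [hC, ENNReal.rpow_lt_top_iff_of_pos (by positivity)]
  constructor
  · intro hcomp
    have hfin := lintegral_ne_top_of_lapCompact hlam hq hv hvpos hcomp
    have h := ne_top_of_le_ne_top hfin (le_lintegral_lapWeight_rpow hlam hq hv)
    exact ENNReal.lt_top_of_mul_ne_top_right h (by simpa using hq0)
  · intro hfin
    refine lapCompact_of_lintegral_ne_top hq hv hvpos ?_
    exact ne_top_of_le_ne_top
      (ENNReal.mul_ne_top (ENNReal.rpow_ne_top_of_nonneg hq0.le (by simp)) hfin.ne)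
      (lintegral_lapWeight_rpow_le hlam hq hv hvpos)
end
end
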